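/- (Macdonald identity, untwisted case.) Let R_f be a reduced irreducible finite root system of rank l with highest root θ and dual Coxeter number h^∨ = 1 + I_f(ρ_f, θ^∨). Set D = l + |R_f| (the dimension of the simple Lie algebra with root system R_f) and c = (I_f(θ,θ)/2)·h^∨. Then for every real q with 0 < q < 1, η(q)^D = Σ_{γ ∈ c·Q(R_f^∨)} d(γ) · q^{(2/I_f(θ,θ)) · I_f(ρ_f + γ, ρ_f + γ)/(2 h^∨)}, and the series on the right-hand side converges absolutely. -/

import Mathlib

open scoped BigOperators Classical

/-- A reduced irreducible finite root system spanning a real vector space `V`,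
equipped with a positive definite symmetric bilinear form `I`. -/
structure RootSys (V : Type) [AddCommGroup V] [Module ℝ V] where
  I : V →ₗ[ℝ] V →ₗ[ℝ] ℝ
  symm : ∀ x y : V, I x y = I y x
  posdef : ∀ x : V, x ≠ 0 → 0 < I x x
  R : Finset V
  zero_notmem : (0 : V) ∉ R
  spanning : Submodule.span ℝ (R : Set V) = ⊤
  reduced : ∀ α ∈ R, ∀ c : ℝ, c • α ∈ R → c = 1 ∨ c = -1
  integral : ∀ α ∈ R, ∀ β ∈ R, ∃ n : ℤ, I ((2 / I α α) • α) β = (n : ℝ)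
  reflect : ∀ α ∈ R, ∀ β ∈ R, β - (I ((2 / I α α) • α) β) • α ∈ R
  irred : ∀ R₁ R₂ : Finset V, R₁ ∪ R₂ = R →
    (∀ α ∈ R₁, ∀ β ∈ R₂, I α β = 0) → R₁ = ∅ ∨ R₂ = ∅

/-- A choice of positive roots and simple roots for a finite root system. -/
structure Base {V : Type} [AddCommGroup V] [Module ℝ V] (S : RootSys V) where
  Pos : Finset V
  Pi : Finset V
  pos_sub : Pos ⊆ S.R
  mem_or_neg : ∀ α ∈ S.R, α ∈ Pos ∨ -α ∈ Pos
  not_both : ∀ α ∈ Pos, -α ∉ Pos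
  pi_sub : Pi ⊆ Pos
  indep : LinearIndependent ℝ (fun b : {x // x ∈ Pi} => (b : V))
  decomp : ∀ α ∈ Pos, ∃ c : V → ℕ, α = ∑ b ∈ Pi, (c b : ℝ) • b

/-- The Weyl vector: half the sum of the positive roots. -/
noncomputable def weylVec {V : Type} [AddCommGroup V] [Module ℝ V] {S : RootSys V}
    (B : Base S) : V := (2 : ℝ)⁻¹ • ∑ α ∈ B.Pos, α

/-- The coroot lattice `Q(R^∨)`, generated by the coroots `α^∨ = (2/I(α,α))•α`. -/
noncomputable def corootLat {V : Type} [AddCommGroup V] [Module ℝ V] (S : RootSys V) :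
    AddSubgroup V := AddSubgroup.closure {x : V | ∃ α ∈ S.R, x = (2 / S.I α α) • α}

/-- The factor `d(λ) = ∏_{α ∈ R⁺} I(λ+ρ,α)/I(ρ,α)`. -/
noncomputable def dFun {V : Type} [AddCommGroup V] [Module ℝ V] {S : RootSys V}
    (B : Base S) (lam : V) : ℝ :=
  ∏ α ∈ B.Pos, (S.I (lam + weylVec B) α / S.I (weylVec B) α)

/-- The Dedekind eta function, `η(q) = q^{1/24} ∏_{n=1}^∞ (1 - qⁿ)`, for real `0 < q < 1`. -/
noncomputable def eta (q : ℝ) : ℝ := q ^ ((1 : ℝ) / 24) * ∏' n : ℕ, (1 - q ^ (n + 1))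

theorem HasSum.of_eq {β : Type*} {f g : β → ℝ} {a b : ℝ} (h : HasSum f a) (hf : ∀ x, g x = f x)
    (hb : b = a) : HasSum g b := by
  rw [hb, funext hf]; exact h

theorem summable_abs_pow_mul_rpow_sq (q : ℝ) (hq0 : 0 < q) (hq1 : q < 1) (n : ℕ) :
    Summable (fun k : ℤ => |(k : ℝ) + 1 / 2| ^ n * q ^ (((k : ℝ) + 1 / 2) ^ 2 / 2)) := by
  have hlog : Real.log q < 0 := Real.log_neg hq0 hq1
  set T : ℝ := -Real.log q / (2 * Real.pi) with hT
  have hTpos : 0 < T := by rw [hT]; have := Real.pi_pos; apply div_pos <;> linarith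
  have h1 := summable_pow_mul_jacobiTheta₂_term_bound (T / 2) hTpos n
  have h0 := summable_pow_mul_jacobiTheta₂_term_bound (T / 2) hTpos 0
  refine Summable.of_nonneg_of_le (fun k => by positivity) (fun k => ?_)
    ((h1.add h0).mul_left (2 ^ n))
  have hexp : q ^ (((k : ℝ) + 1 / 2) ^ 2 / 2) ≤
      Real.exp (-Real.pi * (T * (k : ℝ) ^ 2 - 2 * (T / 2) * (|k| : ℤ))) := by
    rw [Real.rpow_def_of_pos hq0]
    apply Real.exp_le_exp.2
    have hTl : Real.log q = -(2 * Real.pi * T) := by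
      rw [hT]; field_simp
    rw [hTl]
    have : -(|k| : ℝ) ≤ k := neg_abs_le _
    have hp : 0 < Real.pi * T := mul_pos Real.pi_pos hTpos
    push_cast
    nlinarith [mul_le_mul_of_nonneg_left this hp.le]
  have hpow : |(k : ℝ) + 1 / 2| ^ n ≤ 2 ^ n * (((|k| : ℤ) : ℝ) ^ n + ((|k| : ℤ) : ℝ) ^ 0) := by
    have hb : |(k : ℝ) + 1 / 2| ≤ |(k : ℝ)| + 1 := by
      refine (abs_add_le _ _).trans ?_
      norm_num [abs_of_pos]
    push_cast
    have hm : |(k : ℝ)| + 1 ≤ 2 * max |(k : ℝ)| 1 := by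
      linarith [le_max_left |(k : ℝ)| 1, le_max_right |(k : ℝ)| 1]
    calc |(k : ℝ) + 1 / 2| ^ n ≤ (2 * max |(k : ℝ)| 1) ^ n := by
          gcongr; exact hb.trans hm
      _ = 2 ^ n * (max |(k : ℝ)| 1) ^ n := mul_pow _ _ _
      _ ≤ 2 ^ n * (|(k : ℝ)| ^ n + |(k : ℝ)| ^ 0) := by
          gcongr
          rcases max_choice |(k : ℝ)| 1 with h | h <;> rw [h]
          · simp
          · simp
  calc _ ≤ (2 ^ n * (((|k| : ℤ) : ℝ) ^ n + ((|k| : ℤ) : ℝ) ^ 0)) *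
        Real.exp (-Real.pi * (T * (k : ℝ) ^ 2 - 2 * (T / 2) * (|k| : ℤ))) := by gcongr
    _ = _ := by push_cast; ring

/-- The weight `(-1)^k q^{(k+1/2)²/2}`. -/
noncomputable def thetaWt (q : ℝ) (k : ℤ) : ℝ := (-1) ^ k * q ^ (((k : ℝ) + 1 / 2) ^ 2 / 2)

theorem abs_thetaWt (q : ℝ) (hq0 : 0 < q) (k : ℤ) :
    |thetaWt q k| = q ^ (((k : ℝ) + 1 / 2) ^ 2 / 2) := by
  rw [thetaWt, abs_mul, abs_neg_one_zpow, one_mul, abs_of_pos (Real.rpow_pos_of_pos hq0 _)]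

theorem summable_abs_thetaWt (q : ℝ) (hq0 : 0 < q) (hq1 : q < 1) (n : ℕ) :
    Summable (fun k : ℤ => |thetaWt q k| * |(k : ℝ) + 1 / 2| ^ n) := by
  simpa only [abs_thetaWt q hq0, mul_comm] using summable_abs_pow_mul_rpow_sq q hq0 hq1 n

theorem thetaWt_neg (q : ℝ) (k : ℤ) : thetaWt q (-1 - k) = -thetaWt q k := by
  unfold thetaWt
  have h1 : (-1 : ℝ) ^ (-1 - k) = -(-1 : ℝ) ^ k := by
    rw [zpow_sub₀ (by norm_num)]
    rcases Int.even_or_odd k with h | h <;> simp [h.neg_one_zpow]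
  rw [h1]
  have : (((-1 - k : ℤ) : ℝ) + 1 / 2) ^ 2 / 2 = ((k : ℝ) + 1 / 2) ^ 2 / 2 := by push_cast; ring
  rw [this]; ring

/-- The finite product `(q;q)_n`. -/
noncomputable def qPoch (q : ℝ) (n : ℕ) : ℝ := ∏ i ∈ Finset.range n, (1 - q ^ (i + 1))

/-- The reciprocal of `(q;q)_m`, extended by zero to negative `m`. -/
noncomputable def qPochInv (q : ℝ) (m : ℤ) : ℝ := if 0 ≤ m then (qPoch q m.toNat)⁻¹ else 0

theorem qPoch_pos (q : ℝ) (hq0 : 0 < q) (hq1 : q < 1) (n : ℕ) : 0 < qPoch q n :=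
  Finset.prod_pos fun i _ => by
    have : q ^ (i + 1) < 1 := pow_lt_one₀ hq0.le hq1 (by omega)
    linarith

theorem qPochInv_sub_one (q : ℝ) (hq0 : 0 < q) (hq1 : q < 1) (m : ℤ) :
    qPochInv q (m - 1) = (1 - q ^ m) * qPochInv q m := by
  unfold qPochInv
  rcases lt_trichotomy m 0 with h | h | h
  · rw [if_neg (by omega), if_neg (by omega), mul_zero]
  · subst h; simp
  · rw [if_pos (by omega), if_pos (by omega)]
    obtain ⟨n, rfl⟩ : ∃ n : ℕ, m = n + 1 := ⟨(m - 1).toNat, by omega⟩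
    have h2 : ((n : ℤ) + 1 - 1).toNat = n := by omega
    have h3 : ((n : ℤ) + 1).toNat = n + 1 := by omega
    rw [h2, h3]
    have h4 : qPoch q (n + 1) = qPoch q n * (1 - q ^ (n + 1)) := Finset.prod_range_succ _ _
    have h5 : q ^ ((n : ℤ) + 1) = q ^ (n + 1) := by exact_mod_cast zpow_natCast q (n + 1)
    have h6 : (1 - q ^ (n + 1)) ≠ 0 := by
      have : q ^ (n + 1) < 1 := pow_lt_one₀ hq0.le hq1 (by omega)
      linarith
    rw [h4, h5]
    have := (qPoch_pos q hq0 hq1 n).ne'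
    field_simp

/-- The Gaussian binomial coefficient with upper index `2 n + 1` and lower index `n - j`. -/
noncomputable def qBinom (q : ℝ) (n : ℕ) (j : ℤ) : ℝ :=
  qPoch q (2 * n + 1) * (qPochInv q (n - j) * qPochInv q (n + j + 1))

theorem qBinom_succ (q : ℝ) (hq0 : 0 < q) (hq1 : q < 1) (n : ℕ) (j : ℤ) :
    qBinom q (n + 1) j = (1 + q ^ (2 * (n + 1))) * qBinom q n j
      + q ^ ((n : ℤ) + 1 - j) * qBinom q n (j - 1) + q ^ ((n : ℤ) + 1 + j + 1) * qBinom q n (j + 1) := by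
  unfold qBinom
  have hA1 := qPochInv_sub_one q hq0 hq1 (n + 1 - j)
  have hA2 := qPochInv_sub_one q hq0 hq1 (n - j)
  have hB1 := qPochInv_sub_one q hq0 hq1 (n + j + 1 + 1)
  have hB2 := qPochInv_sub_one q hq0 hq1 (n + j + 1)
  rw [show (n : ℤ) + 1 - j - 1 = n - j by ring] at hA1
  rw [show (n : ℤ) + j + 1 + 1 - 1 = n + j + 1 by ring] at hB1
  push_cast
  rw [show (n : ℤ) + 1 + j + 1 = n + j + 1 + 1 by ring,
    show (n : ℤ) - (j - 1) = n + 1 - j by ring, show (n : ℤ) + (j - 1) + 1 = n + j + 1 - 1 by ring,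
    show (n : ℤ) - (j + 1) = n - j - 1 by ring, show (n : ℤ) + (j + 1) + 1 = n + j + 1 + 1 by ring,
    hB2, hA2, hA1, hB1]
  have hp : qPoch q (2 * (n + 1) + 1) =
      qPoch q (2 * n + 1) * (1 - q ^ (2 * n + 2)) * (1 - q ^ (2 * n + 3)) := by
    unfold qPoch
    rw [show 2 * (n + 1) + 1 = 2 * n + 1 + 1 + 1 by ring, Finset.prod_range_succ,
      Finset.prod_range_succ]
  rw [hp]
  have hX : q ^ ((n : ℤ) + 1 - j) = q ^ ((n : ℤ) - j) * q := by
    rw [← zpow_add_one₀ hq0.ne']; congr 1; ring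
  have hY : q ^ ((n : ℤ) + j + 1 + 1) = q ^ ((n : ℤ) + j + 1) * q := by
    rw [← zpow_add_one₀ hq0.ne']
  have hXY : q ^ (2 * n + 2) = q ^ ((n : ℤ) - j) * q ^ ((n : ℤ) + j + 1) * q := by
    rw [← zpow_add₀ hq0.ne', ← zpow_add_one₀ hq0.ne', ← zpow_natCast]; congr 1; push_cast; ring
  have hXY' : q ^ (2 * n + 3) = q ^ (2 * n + 2) * q := by rw [← pow_succ]
  rw [show 2 * (n + 1) = 2 * n + 2 by ring, hXY', hXY, hX, hY]
  ring

theorem multipliable_one_sub_pow (q : ℝ) (hq0 : 0 < q) (hq1 : q < 1) :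
    Multipliable (fun n : ℕ => 1 - q ^ (n + 1)) := by
  have : Summable (fun n : ℕ => ‖-q ^ (n + 1)‖) := by
    simp only [norm_neg, norm_pow, Real.norm_eq_abs, abs_of_pos hq0]
    exact (summable_geometric_of_lt_one hq0.le hq1).comp_injective (add_left_injective 1)
  simpa only [sub_eq_add_neg] using multipliable_one_add_of_summable this

theorem qPoch_antitone (q : ℝ) (hq0 : 0 < q) (hq1 : q < 1) : Antitone (qPoch q) := by
  refine antitone_nat_of_succ_le fun n => ?_
  have h4 : qPoch q (n + 1) = qPoch q n * (1 - q ^ (n + 1)) := Finset.prod_range_succ _ _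
  rw [h4]
  have h1 := qPoch_pos q hq0 hq1 n
  have h2 : 0 < q ^ (n + 1) := by positivity
  nlinarith

theorem tendsto_qPoch (q : ℝ) (hq0 : 0 < q) (hq1 : q < 1) :
    Filter.Tendsto (qPoch q) Filter.atTop (nhds (∏' n : ℕ, (1 - q ^ (n + 1)))) :=
  (multipliable_one_sub_pow q hq0 hq1).hasProd.tendsto_prod_nat

theorem tprod_one_sub_pow_pos (q : ℝ) (hq0 : 0 < q) (hq1 : q < 1) :
    0 < ∏' n : ℕ, (1 - q ^ (n + 1)) := by
  have hne : ∏' n : ℕ, (1 - q ^ (n + 1)) ≠ 0 := by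
    have : Summable (fun n : ℕ => ‖-q ^ (n + 1)‖) := by
      simp only [norm_neg, norm_pow, Real.norm_eq_abs, abs_of_pos hq0]
      exact (summable_geometric_of_lt_one hq0.le hq1).comp_injective (add_left_injective 1)
    have h := tprod_one_add_ne_zero_of_summable (f := fun n : ℕ => -q ^ (n + 1)) (fun n => ?_) this
    · simpa only [sub_eq_add_neg] using h
    · have : q ^ (n + 1) < 1 := pow_lt_one₀ hq0.le hq1 (by omega)
      simp only [ne_eq]; intro h; linarith
  exact lt_of_le_of_ne (ge_of_tendsto' (tendsto_qPoch q hq0 hq1)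
    fun n => (qPoch_pos q hq0 hq1 n).le) hne.symm

theorem tprod_le_qPoch (q : ℝ) (hq0 : 0 < q) (hq1 : q < 1) (n : ℕ) :
    ∏' n : ℕ, (1 - q ^ (n + 1)) ≤ qPoch q n :=
  (qPoch_antitone q hq0 hq1).le_of_tendsto (tendsto_qPoch q hq0 hq1) n

theorem qPochInv_nonneg (q : ℝ) (hq0 : 0 < q) (hq1 : q < 1) (m : ℤ) : 0 ≤ qPochInv q m := by
  unfold qPochInv
  split_ifs
  · exact (inv_pos.2 (qPoch_pos q hq0 hq1 _)).le
  · exact le_rfl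

theorem qPochInv_le (q : ℝ) (hq0 : 0 < q) (hq1 : q < 1) (m : ℤ) :
    qPochInv q m ≤ (∏' n : ℕ, (1 - q ^ (n + 1)))⁻¹ := by
  have hP := tprod_one_sub_pow_pos q hq0 hq1
  unfold qPochInv
  split_ifs
  · exact inv_anti₀ hP (tprod_le_qPoch q hq0 hq1 _)
  · exact (inv_pos.2 hP).le

theorem abs_qBinom_le (q : ℝ) (hq0 : 0 < q) (hq1 : q < 1) (n : ℕ) (j : ℤ) :
    |qBinom q n j| ≤ (∏' n : ℕ, (1 - q ^ (n + 1)))⁻¹ * (∏' n : ℕ, (1 - q ^ (n + 1)))⁻¹ := by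
  have h0 : qPoch q (2 * n + 1) ≤ 1 := qPoch_antitone q hq0 hq1 (Nat.zero_le _)
  have hp := qPoch_pos q hq0 hq1 (2 * n + 1)
  have h1 := qPochInv_nonneg q hq0 hq1 (n - j)
  have h2 := qPochInv_nonneg q hq0 hq1 (n + j + 1)
  unfold qBinom
  rw [abs_of_nonneg (by positivity)]
  calc _ ≤ 1 * (qPochInv q (n - j) * qPochInv q (n + j + 1)) := by gcongr
    _ ≤ _ := by
      rw [one_mul]
      exact mul_le_mul (qPochInv_le q hq0 hq1 _) (qPochInv_le q hq0 hq1 _) h2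
        (inv_pos.2 (tprod_one_sub_pow_pos q hq0 hq1)).le

theorem tendsto_qBinom (q : ℝ) (hq0 : 0 < q) (hq1 : q < 1) (j : ℤ) :
    Filter.Tendsto (fun n => qBinom q n j) Filter.atTop
      (nhds (∏' n : ℕ, (1 - q ^ (n + 1)))⁻¹) := by
  set P := ∏' n : ℕ, (1 - q ^ (n + 1)) with hP
  have hPpos : 0 < P := tprod_one_sub_pow_pos q hq0 hq1
  have hinv : ∀ c : ℤ, Filter.Tendsto (fun n : ℕ => qPochInv q (n + c)) Filter.atTop (nhds P⁻¹) := by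
    intro c
    have h1 : Filter.Tendsto (fun n : ℕ => ((n : ℤ) + c).toNat) Filter.atTop Filter.atTop := by
      refine Filter.tendsto_atTop.2 fun b => ?_
      filter_upwards [Filter.eventually_ge_atTop (b + c.natAbs)] with n hn
      omega
    have h2 := ((tendsto_qPoch q hq0 hq1).comp h1).inv₀ hPpos.ne'
    refine h2.congr' ?_
    filter_upwards [Filter.eventually_ge_atTop c.natAbs] with n hn
    simp only [Function.comp, qPochInv]
    rw [if_pos (by omega)]
  have h3 : Filter.Tendsto (fun n : ℕ => qPoch q (2 * n + 1)) Filter.atTop (nhds P) := by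
    refine (tendsto_qPoch q hq0 hq1).comp ?_
    exact Filter.tendsto_atTop_mono (fun n => by simp only [id]; omega) Filter.tendsto_id
  have h4 := h3.mul ((hinv (-j)).mul (hinv (j + 1)))
  have h5 : P * (P⁻¹ * P⁻¹) = P⁻¹ := by field_simp
  rw [h5] at h4
  refine h4.congr fun n => ?_
  unfold qBinom
  rw [← sub_eq_add_neg, ← add_assoc]

theorem thetaWt_sub_one (q : ℝ) (hq0 : 0 < q) (n : ℕ) (j : ℤ) :
    thetaWt q j * q ^ ((n : ℤ) + 1 - j) = -(q ^ (n + 1) * thetaWt q (j - 1)) := by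
  unfold thetaWt
  rw [zpow_sub_one₀ (a := (-1 : ℝ)) (by norm_num), ← Real.rpow_intCast q, ← Real.rpow_natCast q (n + 1), mul_assoc,
    ← Real.rpow_add hq0, mul_left_comm, ← Real.rpow_add hq0]
  have : ((j : ℝ) + 1 / 2) ^ 2 / 2 + ((n : ℤ) + 1 - j : ℤ) =
    ((n + 1 : ℕ) : ℝ) + (((j - 1 : ℤ) : ℝ) + 1 / 2) ^ 2 / 2 := by push_cast; ring
  rw [this]; norm_num

theorem thetaWt_add_one (q : ℝ) (hq0 : 0 < q) (n : ℕ) (j : ℤ) :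
    thetaWt q j * q ^ ((n : ℤ) + 1 + j + 1) = -(q ^ (n + 1) * thetaWt q (j + 1)) := by
  unfold thetaWt
  rw [zpow_add_one₀ (a := (-1 : ℝ)) (by norm_num), ← Real.rpow_intCast q, ← Real.rpow_natCast q (n + 1), mul_assoc,
    ← Real.rpow_add hq0, mul_left_comm, ← Real.rpow_add hq0]
  have : ((j : ℝ) + 1 / 2) ^ 2 / 2 + ((n : ℤ) + 1 + j + 1 : ℤ) =
    ((n + 1 : ℕ) : ℝ) + (((j + 1 : ℤ) : ℝ) + 1 / 2) ^ 2 / 2 := by push_cast; ring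
  rw [this]; norm_num

theorem summable_thetaWt_mul_qBinom (q : ℝ) (hq0 : 0 < q) (hq1 : q < 1) (n m : ℕ) :
    Summable (fun j : ℤ => ((j : ℝ) + 1 / 2) ^ m * (thetaWt q j * qBinom q n j)) := by
  refine Summable.of_norm_bounded ((summable_abs_thetaWt q hq0 hq1 m).mul_right
    ((∏' n : ℕ, (1 - q ^ (n + 1)))⁻¹ * (∏' n : ℕ, (1 - q ^ (n + 1)))⁻¹)) fun j => ?_
  rw [Real.norm_eq_abs, abs_mul, abs_mul, abs_pow, mul_comm, mul_right_comm]
  exact mul_le_mul_of_nonneg_left (abs_qBinom_le q hq0 hq1 n j) (by positivity)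

theorem tsum_thetaWt_mul_qBinom (q : ℝ) (hq0 : 0 < q) (hq1 : q < 1) (n : ℕ) :
    ∑' j : ℤ, ((j : ℝ) + 1 / 2) * (thetaWt q j * qBinom q n j) =
      q ^ ((1 : ℝ) / 8) * qPoch q n ^ 2 := by
  induction n with
  | zero =>
    have hq : (1 : ℝ) - q ≠ 0 := by linarith
    have hz : ∀ j ∉ ({0, -1} : Finset ℤ),
        ((j : ℝ) + 1 / 2) * (thetaWt q j * qBinom q 0 j) = 0 := by
      intro j hj
      have : qBinom q 0 j = 0 := by
        unfold qBinom qPochInv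
        simp only [Finset.mem_insert, Finset.mem_singleton, not_or] at hj
        by_cases h : 0 ≤ j
        · rw [if_neg (by push_cast; omega)]; ring
        · rw [if_neg (show ¬ (0 : ℤ) ≤ ((0 : ℕ) : ℤ) + j + 1 by push_cast; omega)]; ring
      rw [this]; ring
    rw [tsum_eq_sum hz, Finset.sum_pair (by decide)]
    simp [qBinom, qPochInv, qPoch, thetaWt, hq]
    norm_num
    ring
  | succ n ih =>
    set g : ℤ → ℝ := fun j => thetaWt q j * qBinom q n j with hg
    have hs0 : Summable g := by
      simpa using summable_thetaWt_mul_qBinom q hq0 hq1 n 0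
    have hs1 : Summable (fun j : ℤ => ((j : ℝ) + 1 / 2) * g j) := by
      simpa using summable_thetaWt_mul_qBinom q hq0 hq1 n 1
    have hm : HasSum (fun j : ℤ => ((j : ℝ) + 1 / 2) * g (j - 1))
        (∑' j : ℤ, ((j : ℝ) + 1 / 2) * g j + ∑' j, g j) := by
      rw [← (Equiv.addRight (1 : ℤ)).hasSum_iff]
      refine (hs1.hasSum.add hs0.hasSum).of_eq (fun j => ?_) rfl
      simp; ring
    have hp : HasSum (fun j : ℤ => ((j : ℝ) + 1 / 2) * g (j + 1))
        (∑' j : ℤ, ((j : ℝ) + 1 / 2) * g j - ∑' j, g j) := by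
      rw [← (Equiv.subRight (1 : ℤ)).hasSum_iff]
      refine (hs1.hasSum.sub hs0.hasSum).of_eq (fun j => ?_) rfl
      simp; ring
    have key : HasSum (fun j : ℤ => ((j : ℝ) + 1 / 2) * (thetaWt q j * qBinom q (n + 1) j))
        ((1 - q ^ (n + 1)) ^ 2 * ∑' j : ℤ, ((j : ℝ) + 1 / 2) * g j) := by
      refine (((hs1.hasSum.mul_left (1 + q ^ (2 * (n + 1)))).sub (hm.mul_left (q ^ (n + 1)))).sub
        (hp.mul_left (q ^ (n + 1)))).of_eq (fun j => ?_) ?_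
      · rw [qBinom_succ q hq0 hq1]
        have e1 := thetaWt_sub_one q hq0 n j
        have e2 := thetaWt_add_one q hq0 n j
        simp only [hg]
        linear_combination ((j : ℝ) + 1 / 2) * qBinom q n (j - 1) * e1 +
          ((j : ℝ) + 1 / 2) * qBinom q n (j + 1) * e2
      · ring
    rw [key.tsum_eq, ih]
    have h4 : qPoch q (n + 1) = qPoch q n * (1 - q ^ (n + 1)) := Finset.prod_range_succ _ _
    rw [h4]; ring

/-- Jacobi's identity for the cube of the eta function. -/
theorem hasSum_eta_cube (q : ℝ) (hq0 : 0 < q) (hq1 : q < 1) :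
    HasSum (fun j : ℤ => thetaWt q j * ((j : ℝ) + 1 / 2)) (eta q ^ 3) := by
  set P := ∏' n : ℕ, (1 - q ^ (n + 1)) with hP
  have hPpos : 0 < P := tprod_one_sub_pow_pos q hq0 hq1
  have hsum : Summable (fun j : ℤ => ((j : ℝ) + 1 / 2) * thetaWt q j) := by
    refine Summable.of_norm_bounded (summable_abs_thetaWt q hq0 hq1 1) fun j => ?_
    rw [Real.norm_eq_abs, abs_mul, mul_comm, pow_one]
  have h1 : Filter.Tendsto (fun n => ∑' j : ℤ, ((j : ℝ) + 1 / 2) * (thetaWt q j * qBinom q n j))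
      Filter.atTop (nhds (∑' j : ℤ, ((j : ℝ) + 1 / 2) * (thetaWt q j * P⁻¹))) := by
    refine tendsto_tsum_of_dominated_convergence ((summable_abs_thetaWt q hq0 hq1 1).mul_right
      (P⁻¹ * P⁻¹)) (fun j => ?_) (Filter.Eventually.of_forall fun n j => ?_)
    · exact ((tendsto_qBinom q hq0 hq1 j).const_mul _).const_mul _
    · rw [Real.norm_eq_abs, abs_mul, abs_mul, pow_one, mul_left_comm, ← mul_assoc]
      exact mul_le_mul_of_nonneg_left (abs_qBinom_le q hq0 hq1 n j) (by positivity)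
  simp only [tsum_thetaWt_mul_qBinom q hq0 hq1] at h1
  have h2 := ((tendsto_qPoch q hq0 hq1).pow 2).const_mul (q ^ ((1 : ℝ) / 8))
  have h3 := tendsto_nhds_unique h2 h1
  simp only [← mul_assoc] at h3
  rw [tsum_mul_right] at h3
  have h4 : eta q ^ 3 = ∑' j : ℤ, ((j : ℝ) + 1 / 2) * thetaWt q j := by
    unfold eta
    rw [mul_pow, ← Real.rpow_natCast (q ^ ((1 : ℝ) / 24)), ← Real.rpow_mul hq0.le, ← hP]
    rw [← hP] at h3
    have : (1 : ℝ) / 24 * (3 : ℕ) = 1 / 8 := by norm_num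
    rw [this]
    rw [eq_mul_inv_iff_mul_eq₀ hPpos.ne'] at h3
    rw [← h3]
    ring
  rw [h4]
  simpa only [mul_comm] using hsum.hasSum

theorem hasSum_prod_fin (n : ℕ) (f : Fin n → ℤ → ℝ) (hf : ∀ i, Summable fun k => |f i k|) :
    Summable (fun k : Fin n → ℤ => |∏ i, f i (k i)|) ∧
      HasSum (fun k : Fin n → ℤ => ∏ i, f i (k i)) (∏ i, ∑' k, f i k) := by
  induction n with
  | zero =>
    have : HasSum (fun _ : Fin 0 → ℤ => (1 : ℝ)) 1 := by simp
    simp [this.summable]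
  | succ n ih =>
    obtain ⟨h1, h2⟩ := ih (fun i => f i.succ) (fun i => hf i.succ)
    have habs : Summable (fun p : ℤ × (Fin n → ℤ) => |f 0 p.1 * ∏ i, f i.succ (p.2 i)|) := by
      have := (hf 0).mul_of_nonneg h1 (fun _ => abs_nonneg _) (fun _ => abs_nonneg _)
      simpa only [abs_mul] using this
    constructor
    · rw [← (Fin.consEquiv (fun _ : Fin (n + 1) => ℤ)).summable_iff]
      refine habs.congr fun p => ?_
      simp [Fin.prod_univ_succ, Fin.consEquiv]
    · rw [← (Fin.consEquiv (fun _ : Fin (n + 1) => ℤ)).hasSum_iff, Fin.prod_univ_succ, ← h2.tsum_eq,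
        (hf 0).of_abs.tsum_mul_tsum h1.of_abs habs.of_abs]
      refine habs.of_abs.hasSum.of_eq (fun p => ?_) rfl
      simp [Fin.prod_univ_succ, Fin.consEquiv]

theorem hasSum_prod_pi {ι : Type*} [Fintype ι] (f : ι → ℤ → ℝ)
    (hf : ∀ i, Summable fun k => |f i k|) :
    Summable (fun k : ι → ℤ => |∏ i, f i (k i)|) ∧
      HasSum (fun k : ι → ℤ => ∏ i, f i (k i)) (∏ i, ∑' k, f i k) := by
  set e := Fintype.equivFin ι
  obtain ⟨h1, h2⟩ := hasSum_prod_fin _ (fun i => f (e.symm i)) (fun i => hf _)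
  have key : ∀ k : Fin (Fintype.card ι) → ℤ,
      ∏ i, f i ((e.arrowCongr (Equiv.refl ℤ)).symm k i) = ∏ i, f (e.symm i) (k i) := by
    intro k
    rw [← e.symm.prod_comp]
    simp
  constructor
  · rw [← (e.arrowCongr (Equiv.refl ℤ)).symm.summable_iff]
    exact h1.congr fun k => by simp only [Function.comp, key]
  · rw [← (e.arrowCongr (Equiv.refl ℤ)).symm.hasSum_iff]
    refine h2.of_eq (fun k => by simp only [Function.comp, key]) ?_
    exact (e.symm.prod_comp (fun i => ∑' k, f i k)).symm

/-- An odd weight on the half-integers `k + 1/2` with finite absolute moments. -/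
structure OddWeight (w : ℤ → ℝ) : Prop where
  odd : ∀ k, w (-1 - k) = -w k
  summable : ∀ n : ℕ, Summable fun k : ℤ => |w k| * |(k : ℝ) + 1 / 2| ^ n

/-- The moments of a weight on the half-integers. -/
noncomputable def moment (w : ℤ → ℝ) (n : ℕ) : ℝ := ∑' k : ℤ, w k * ((k : ℝ) + 1 / 2) ^ n

theorem OddWeight.moment_even {w : ℤ → ℝ} (hw : OddWeight w) {n : ℕ} (hn : Even n) :
    moment w n = 0 := by
  have h : moment w n = -moment w n := by
    conv_lhs => rw [moment, ← (Equiv.subLeft (-1 : ℤ)).tsum_eq]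
    rw [moment, ← tsum_neg]
    refine tsum_congr fun k => ?_
    simp only [Equiv.subLeft_apply, hw.odd]
    have : ((-1 - k : ℤ) : ℝ) + 1 / 2 = -((k : ℝ) + 1 / 2) := by push_cast; ring
    rw [this, hn.neg_pow]; ring
  linarith

/-- The half-integral vector attached to an integral one. -/
noncomputable def halfShift {ι : Type*} (k : ι → ℤ) (i : ι) : ℝ := (k i : ℝ) + 1 / 2

/-- The product weight. -/
noncomputable def prodWt {ι : Type*} [Fintype ι] (w : ℤ → ℝ) (k : ι → ℤ) : ℝ := ∏ i, w (k i)

section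
variable {ι : Type*} [Fintype ι]

open MvPolynomial

theorem OddWeight.hasSum_eval {w : ℤ → ℝ} (hw : OddWeight w) (F : MvPolynomial ι ℝ) :
    Summable (fun k : ι → ℤ => |prodWt w k * eval (halfShift k) F|) ∧
    HasSum (fun k : ι → ℤ => prodWt w k * eval (halfShift k) F)
      (∑ d ∈ F.support, F.coeff d * ∏ i, moment w (d i)) := by
  have hmono : ∀ d : ι →₀ ℕ,
      Summable (fun k : ι → ℤ => |∏ i, (w (k i) * halfShift k i ^ d i)|) ∧
      HasSum (fun k : ι → ℤ => ∏ i, (w (k i) * halfShift k i ^ d i)) (∏ i, moment w (d i)) := by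
    intro d
    refine hasSum_prod_pi (fun i k => w k * ((k : ℝ) + 1 / 2) ^ d i) (fun i => ?_)
    simpa only [abs_mul, abs_pow] using hw.summable (d i)
  have heq : ∀ k : ι → ℤ, prodWt w k * eval (halfShift k) F =
      ∑ d ∈ F.support, F.coeff d * ∏ i, (w (k i) * halfShift k i ^ d i) := by
    intro k
    rw [eval_eq', Finset.mul_sum]
    refine Finset.sum_congr rfl fun d _ => ?_
    rw [Finset.prod_mul_distrib, prodWt]; ring
  constructor
  · have : Summable (fun k : ι → ℤ =>
        ∑ d ∈ F.support, |F.coeff d| * |∏ i, (w (k i) * halfShift k i ^ d i)|) :=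
      summable_sum fun d _ => (hmono d).1.mul_left _
    refine Summable.of_nonneg_of_le (fun _ => abs_nonneg _) (fun k => ?_) this
    rw [heq]
    refine (Finset.abs_sum_le_sum_abs _ _).trans_eq ?_
    simp only [abs_mul]
  · refine (hasSum_sum fun d _ => ((hmono d).2.mul_left (F.coeff d))).of_eq heq rfl

/-- The multi-index with all entries one. -/
noncomputable def allOnes (ι : Type*) [Fintype ι] : ι →₀ ℕ := Finsupp.equivFunOnFinite.symm fun _ => 1

@[simp] theorem allOnes_apply (i : ι) : allOnes ι i = 1 := rfl

theorem OddWeight.term_eq_zero {w : ℤ → ℝ} (hw : OddWeight w) {F : MvPolynomial ι ℝ} {n : ℕ}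
    (hF : F.IsHomogeneous n) (d : ι →₀ ℕ)
    (h : ¬((∀ i, Odd (d i)) ∧ ∑ i, d i = n)) : F.coeff d * ∏ i, moment w (d i) = 0 := by
  by_cases hd : ∀ i, Odd (d i)
  · have : d.degree ≠ n := by
      rw [Finsupp.degree_eq_sum]; exact fun h' => h ⟨hd, h'⟩
    rw [hF.coeff_eq_zero this, zero_mul]
  · push Not at hd
    obtain ⟨i, hi⟩ := hd
    rw [Finset.prod_eq_zero (Finset.mem_univ i) (hw.moment_even (by simpa using hi)), mul_zero]

theorem OddWeight.tsum_eq_zero {w : ℤ → ℝ} (hw : OddWeight w) {F : MvPolynomial ι ℝ} {n : ℕ}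
    (hF : F.IsHomogeneous n) (hn : n < Fintype.card ι) :
    HasSum (fun k : ι → ℤ => prodWt w k * eval (halfShift k) F) 0 := by
  refine (hw.hasSum_eval F).2.of_eq (fun _ => rfl) (Finset.sum_eq_zero fun d _ => ?_).symm
  refine hw.term_eq_zero hF d fun ⟨h1, h2⟩ => ?_
  have : ∑ i : ι, 1 ≤ ∑ i, d i := Finset.sum_le_sum fun i _ => (h1 i).pos
  simp at this
  omega

theorem OddWeight.hasSum_top {w : ℤ → ℝ} (hw : OddWeight w) {F : MvPolynomial ι ℝ}
    (hF : F.IsHomogeneous (Fintype.card ι)) :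
    HasSum (fun k : ι → ℤ => prodWt w k * eval (halfShift k) F)
      (F.coeff (allOnes ι) * moment w 1 ^ Fintype.card ι) := by
  refine (hw.hasSum_eval F).2.of_eq (fun _ => rfl) ?_
  rw [Finset.sum_eq_single (allOnes ι)]
  · simp
  · intro d _ hd
    refine hw.term_eq_zero hF d fun ⟨h1, h2⟩ => hd ?_
    ext i
    have h3 : ∑ i : ι, 1 = ∑ i, d i := by rw [h2]; simp
    have := (Finset.sum_eq_sum_iff_of_le fun i _ => (h1 i).pos).1 h3 i (Finset.mem_univ i)
    simpa using this.symm
  · intro h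
    rw [notMem_support_iff.1 h, zero_mul]

/-- The Laplacian on polynomials. -/
noncomputable def laplacian (F : MvPolynomial ι ℝ) : MvPolynomial ι ℝ :=
  ∑ i, pderiv i (pderiv i F)

theorem coeff_allOnes_laplacian (F : MvPolynomial ι ℝ) :
    (laplacian F).coeff (allOnes ι) = 6 * ∑ i, F.coeff (allOnes ι + Finsupp.single i 2) := by
  rw [laplacian, coeff_sum, Finset.mul_sum]
  refine Finset.sum_congr rfl fun i _ => ?_
  rw [coeff_pderiv, coeff_pderiv, add_assoc, ← Finsupp.single_add]
  simp
  ring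

theorem OddWeight.hasSum_top_add_two {w : ℤ → ℝ} (hw : OddWeight w) {F : MvPolynomial ι ℝ}
    (hF : F.IsHomogeneous (Fintype.card ι + 2)) :
    HasSum (fun k : ι → ℤ => prodWt w k * eval (halfShift k) F)
      ((laplacian F).coeff (allOnes ι) / 6 * (moment w 1 ^ (Fintype.card ι - 1) * moment w 3)) := by
  refine (hw.hasSum_eval F).2.of_eq (fun _ => rfl) ?_
  rw [coeff_allOnes_laplacian]
  set g : (ι →₀ ℕ) → ℝ := fun d => F.coeff d * ∏ i, moment w (d i) with hg
  have hinj : Function.Injective (fun i : ι => allOnes ι + Finsupp.single i 2) := by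
    intro i j hij
    have h := add_left_cancel hij
    exact ((Finsupp.single_eq_single_iff _ _ _ _).1 h).resolve_right (by simp) |>.1
  have hval : ∀ i, g (allOnes ι + Finsupp.single i 2) =
      F.coeff (allOnes ι + Finsupp.single i 2) * (moment w 1 ^ (Fintype.card ι - 1) * moment w 3) := by
    intro i
    simp only [hg]
    congr 1
    rw [← Finset.prod_erase_mul _ _ (Finset.mem_univ i)]
    congr 1
    · rw [Finset.prod_congr rfl (g := fun _ => moment w 1), Finset.prod_const,
        Finset.card_erase_of_mem (Finset.mem_univ i), Finset.card_univ]
      intro j hj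
      have : j ≠ i := Finset.ne_of_mem_erase hj
      simp [this.symm]
    · simp
  have hmain : ∑ d ∈ F.support, g d = ∑ i, g (allOnes ι + Finsupp.single i 2) := by
    rw [← Finset.sum_image (f := g) (s := Finset.univ)
      (g := fun i : ι => allOnes ι + Finsupp.single i 2) (fun a _ b _ h => hinj h)]
    rw [Finset.sum_subset (Finset.subset_union_left
        (s₂ := Finset.univ.image fun i : ι => allOnes ι + Finsupp.single i 2)) (f := g),
      ← Finset.sum_subset (Finset.subset_union_right (s₁ := F.support)
        (s₂ := Finset.univ.image fun i : ι => allOnes ι + Finsupp.single i 2)) (f := g)]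
    · intro d _ hd
      refine hw.term_eq_zero hF d fun ⟨h1, h2⟩ => hd ?_
      choose c hc using h1
      have hsum : ∑ i, c i = 1 := by
        have : ∑ i, (2 * c i + 1) = Fintype.card ι + 2 := by
          rw [← h2]; exact Finset.sum_congr rfl fun i _ => (hc i).symm
        rw [Finset.sum_add_distrib, ← Finset.mul_sum] at this
        simp at this
        omega
      obtain ⟨i, hi⟩ : ∃ i, c i ≠ 0 := by
        by_contra hcon
        push Not at hcon
        simp [hcon] at hsum
      rw [← Finset.add_sum_erase _ _ (Finset.mem_univ i)] at hsum
      have hz : ∀ j, j ≠ i → c j = 0 := by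
        intro j hj
        have : ∑ j ∈ Finset.univ.erase i, c j = 0 := by omega
        exact (Finset.sum_eq_zero_iff.1 this) j (Finset.mem_erase.2 ⟨hj, Finset.mem_univ j⟩)
      refine Finset.mem_image.2 ⟨i, Finset.mem_univ i, ?_⟩
      ext j
      by_cases hj : j = i
      · subst hj
        have : c j = 1 := by omega
        simp [hc j, this]
      · simp [hc j, hz j hj, Ne.symm hj]
    · intro d _ hd
      simp only [hg]
      rw [notMem_support_iff.1 hd, zero_mul]
  change _ = ∑ d ∈ F.support, g d
  rw [hmain, Finset.sum_congr rfl fun i _ => hval i, ← Finset.sum_mul]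
  ring

end

section
variable {ι : Type*} [Fintype ι]

open MvPolynomial

/-- The linear form given by a row of a matrix. -/
noncomputable def rowForm (G : Matrix ι ι ℝ) (i : ι) : MvPolynomial ι ℝ := ∑ j, C (G i j) * X j

/-- The product of all row forms. -/
noncomputable def rowProd (G : Matrix ι ι ℝ) : MvPolynomial ι ℝ := ∏ i, rowForm G i

/-- The quadratic form of a matrix. -/
noncomputable def quadPoly (G : Matrix ι ι ℝ) : MvPolynomial ι ℝ := ∑ i, X i * rowForm G i

theorem rowForm_isHomogeneous (G : Matrix ι ι ℝ) (i : ι) : (rowForm G i).IsHomogeneous 1 :=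
  IsHomogeneous.sum _ _ _ fun j _ => by
    simpa using (isHomogeneous_C ι (G i j)).mul (isHomogeneous_X ℝ j)

theorem rowProd_isHomogeneous (G : Matrix ι ι ℝ) :
    (rowProd G).IsHomogeneous (Fintype.card ι) := by
  simpa [rowProd] using IsHomogeneous.prod Finset.univ (rowForm G) (fun _ => 1)
    fun i _ => rowForm_isHomogeneous G i

theorem quadPoly_isHomogeneous (G : Matrix ι ι ℝ) : (quadPoly G).IsHomogeneous 2 :=
  IsHomogeneous.sum _ _ _ fun i _ => (isHomogeneous_X ℝ i).mul (rowForm_isHomogeneous G i)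

theorem laplacian_isHomogeneous {F : MvPolynomial ι ℝ} {n : ℕ} (hF : F.IsHomogeneous n) :
    (laplacian F).IsHomogeneous (n - 1 - 1) :=
  IsHomogeneous.sum _ _ _ fun _ _ => hF.pderiv.pderiv

theorem pderiv_rowForm (G : Matrix ι ι ℝ) (i j : ι) :
    pderiv j (rowForm G i) = C (G i j) := by
  simp [rowForm, pderiv_X, Pi.single_apply, Derivation.leibniz]

theorem pderiv_quadPoly (G : Matrix ι ι ℝ) (hG : ∀ i j, G i j = G j i) (j : ι) :
    pderiv j (quadPoly G) = 2 * rowForm G j := by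
  have : ∑ i, X i * C (G i j) = rowForm G j :=
    Finset.sum_congr rfl fun i _ => by rw [hG j i, mul_comm]
  simp only [quadPoly, map_sum, pderiv_mul, pderiv_rowForm, pderiv_X, Finset.sum_add_distrib, this]
  simp [Pi.single_apply]
  ring

theorem sum_rowForm_mul_pderiv_rowProd (G : Matrix ι ι ℝ) (h : ℝ)
    (hsq : ∀ i j, ∑ k, G i k * G k j = h * G i j) :
    ∑ j, rowForm G j * pderiv j (rowProd G) = C (h * Fintype.card ι) * rowProd G := by
  have hlin : ∀ i, ∑ j, rowForm G j * pderiv j (rowForm G i) = C h * rowForm G i := by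
    intro i
    simp only [pderiv_rowForm]
    simp only [rowForm, Finset.sum_mul, Finset.mul_sum]
    rw [Finset.sum_comm]
    refine Finset.sum_congr rfl fun k _ => ?_
    rw [← mul_assoc, ← C_mul, ← hsq, map_sum, Finset.sum_mul]
    refine Finset.sum_congr rfl fun j _ => ?_
    rw [C_mul]; ring
  have hfin : ∀ s : Finset ι, ∑ j, rowForm G j * pderiv j (∏ i ∈ s, rowForm G i) =
      C (h * s.card) * ∏ i ∈ s, rowForm G i := by
    intro s
    induction s using Finset.induction_on with
    | empty => simp
    | insert a s ha ih =>
      simp only [Finset.prod_insert ha, pderiv_mul, mul_add, Finset.sum_add_distrib]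
      have e1 : ∑ j, rowForm G j * (pderiv j (rowForm G a) * ∏ i ∈ s, rowForm G i) =
          (∑ j, rowForm G j * pderiv j (rowForm G a)) * ∏ i ∈ s, rowForm G i := by
        rw [Finset.sum_mul]; exact Finset.sum_congr rfl fun j _ => by ring
      have e2 : ∑ j, rowForm G j * (rowForm G a * pderiv j (∏ i ∈ s, rowForm G i)) =
          rowForm G a * ∑ j, rowForm G j * pderiv j (∏ i ∈ s, rowForm G i) := by
        rw [Finset.mul_sum]; exact Finset.sum_congr rfl fun j _ => by ring
      rw [e1, e2, hlin, ih, Finset.card_insert_of_notMem ha]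
      simp only [Nat.cast_add, Nat.cast_one, mul_add, mul_one, C_add]
      ring
  simpa [rowProd] using hfin Finset.univ

theorem laplacian_rowProd_mul_quadPoly (G : Matrix ι ι ℝ) (hG : ∀ i j, G i j = G j i) (h : ℝ)
    (hsq : ∀ i j, ∑ k, G i k * G k j = h * G i j) :
    laplacian (rowProd G * quadPoly G) = laplacian (rowProd G) * quadPoly G +
      C (4 * (h * Fintype.card ι) + 2 * ∑ i, G i i) * rowProd G := by
  have h1 := sum_rowForm_mul_pderiv_rowProd G h hsq
  have h2 : ∀ j, pderiv j (pderiv j (rowProd G * quadPoly G)) =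
      pderiv j (pderiv j (rowProd G)) * quadPoly G +
        4 * (rowForm G j * pderiv j (rowProd G)) + 2 * C (G j j) * rowProd G := by
    intro j
    rw [pderiv_mul, map_add, pderiv_mul, pderiv_mul, pderiv_quadPoly G hG]
    have : pderiv j (2 * rowForm G j) = 2 * C (G j j) := by
      rw [show (2 : MvPolynomial ι ℝ) = C 2 from rfl, pderiv_C_mul, pderiv_rowForm]
    rw [this]; ring
  simp only [laplacian, h2, Finset.sum_add_distrib, ← Finset.mul_sum, ← Finset.sum_mul, h1]
  simp only [C_add, C_mul, map_sum]
  have e4 : (C 4 : MvPolynomial ι ℝ) = 4 := rfl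
  have e2 : (C 2 : MvPolynomial ι ℝ) = 2 := rfl
  rw [e4, e2]; ring

theorem pderiv_mem_adjoin (G : Matrix ι ι ℝ) (j : ι) {F : MvPolynomial ι ℝ}
    (hF : F ∈ Algebra.adjoin ℝ (Set.range (rowForm G))) :
    pderiv j F ∈ Algebra.adjoin ℝ (Set.range (rowForm G)) := by
  induction hF using Algebra.adjoin_induction with
  | mem x hx =>
    obtain ⟨i, rfl⟩ := hx
    rw [pderiv_rowForm]
    exact Subalgebra.algebraMap_mem _ (G i j)
  | algebraMap r =>
    have : pderiv j (algebraMap ℝ (MvPolynomial ι ℝ) r) = 0 := pderiv_C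
    rw [this]; exact Subalgebra.zero_mem _
  | add x y _ _ hx hy => rw [map_add]; exact Subalgebra.add_mem _ hx hy
  | mul x y hx' hy' hx hy =>
    rw [pderiv_mul]
    exact Subalgebra.add_mem _ (Subalgebra.mul_mem _ hx hy') (Subalgebra.mul_mem _ hx' hy)

theorem eval_laplacian_rowProd_congr (G : Matrix ι ι ℝ) (x y : ι → ℝ)
    (hxy : ∀ i, eval x (rowForm G i) = eval y (rowForm G i)) :
    eval x (laplacian (rowProd G)) = eval y (laplacian (rowProd G)) := by
  have hmem : laplacian (rowProd G) ∈ Algebra.adjoin ℝ (Set.range (rowForm G)) := by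
    refine Subalgebra.sum_mem _ fun j _ => pderiv_mem_adjoin G j (pderiv_mem_adjoin G j ?_)
    exact Subalgebra.prod_mem _ fun i _ => Algebra.subset_adjoin ⟨i, rfl⟩
  generalize laplacian (rowProd G) = F at hmem
  induction hmem using Algebra.adjoin_induction with
  | mem x hx => obtain ⟨i, rfl⟩ := hx; exact hxy i
  | algebraMap r => simp [algebraMap_eq]
  | add _ _ _ _ hx hy => rw [map_add, map_add, hx, hy]
  | mul _ _ _ _ hx hy => rw [map_mul, map_mul, hx, hy]

end

namespace RootSys

variable {V : Type} [AddCommGroup V] [Module ℝ V] (S : RootSys V)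

/-- The coroot of `α`. -/
noncomputable def coroot (α : V) : V := (2 / S.I α α) • α

/-- The reflection in `α`. -/
noncomputable def refl (α : V) : V →ₗ[ℝ] V := LinearMap.id - (S.I (S.coroot α)).smulRight α

theorem refl_apply (α x : V) : S.refl α x = x - S.I (S.coroot α) x • α := rfl

variable {S}

theorem ne_zero_of_mem {α : V} (hα : α ∈ S.R) : α ≠ 0 := fun h => S.zero_notmem (h ▸ hα)

theorem norm_pos {α : V} (hα : α ∈ S.R) : 0 < S.I α α := S.posdef α (ne_zero_of_mem hα)

theorem eq_zero_of_norm_le {x : V} (h : S.I x x ≤ 0) : x = 0 := by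
  by_contra hx
  exact absurd (S.posdef x hx) (not_lt.2 h)

theorem coroot_apply (α x : V) : S.I (S.coroot α) x = 2 / S.I α α * S.I α x := by
  simp [coroot]

theorem coroot_self {α : V} (hα : α ∈ S.R) : S.I (S.coroot α) α = 2 := by
  rw [coroot_apply]; have := (norm_pos hα).ne'; field_simp

theorem refl_self {α : V} (hα : α ∈ S.R) : S.refl α α = -α := by
  rw [refl_apply, coroot_self hα]; module

theorem refl_mem {α β : V} (hα : α ∈ S.R) (hβ : β ∈ S.R) : S.refl α β ∈ S.R :=
  S.reflect α hα β hβ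

theorem neg_mem {α : V} (hα : α ∈ S.R) : -α ∈ S.R := by
  rw [← refl_self hα]; exact refl_mem hα hα

theorem refl_neg (α : V) : S.refl (-α) = S.refl α := by
  ext x; simp [refl_apply, coroot]

theorem refl_isometry {α : V} (hα : α ∈ S.R) (x y : V) :
    S.I (S.refl α x) (S.refl α y) = S.I x y := by
  have h := (norm_pos hα).ne'
  simp only [refl_apply, coroot_apply, map_sub, map_smul, LinearMap.sub_apply, LinearMap.smul_apply,
    smul_eq_mul]
  rw [S.symm x α]
  field_simp
  ring

theorem refl_refl {α : V} (hα : α ∈ S.R) (x : V) : S.refl α (S.refl α x) = x := by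
  rw [refl_apply, refl_apply, map_sub, map_smul, coroot_self hα, smul_eq_mul]
  module

theorem refl_adjoint {α : V} (hα : α ∈ S.R) (x y : V) :
    S.I (S.refl α x) y = S.I x (S.refl α y) := by
  rw [← refl_isometry hα, refl_refl hα]

theorem refl_coroot {α β : V} (hα : α ∈ S.R) :
    S.refl α (S.coroot β) = S.coroot (S.refl α β) := by
  unfold coroot
  rw [map_smul, refl_isometry hα]

theorem eq_zero_of_orthogonal {x : V} (h : ∀ α ∈ S.R, S.I x α = 0) : x = 0 := by
  have hx : x ∈ Submodule.span ℝ (S.R : Set V) := by rw [S.spanning]; trivial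
  have key : ∀ y ∈ Submodule.span ℝ (S.R : Set V), S.I x y = 0 := by
    intro y hy
    induction hy using Submodule.span_induction with
    | mem y hy => exact h y hy
    | zero => simp
    | add y z _ _ hy hz => simp [hy, hz]
    | smul c y _ hy => simp [hy]
  exact eq_zero_of_norm_le (key x hx).le

end RootSys

namespace Base

open RootSys

variable {V : Type} [AddCommGroup V] [Module ℝ V] {S : RootSys V} (B : Base S)

/-- The positive one among `α` and `-α`. -/
noncomputable def posRep (α : V) : V := if α ∈ B.Pos then α else -α

/-- The sign of a root. -/
noncomputable def sgn (α : V) : ℝ := if α ∈ B.Pos then 1 else -1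

variable {B}

theorem mem_R {α : V} (hα : α ∈ B.Pos) : α ∈ S.R := B.pos_sub hα

theorem posRep_mem {α : V} (hα : α ∈ S.R) : B.posRep α ∈ B.Pos := by
  unfold posRep
  split_ifs with h
  · exact h
  · exact (B.mem_or_neg α hα).resolve_left h

theorem posRep_eq_self {α : V} (hα : α ∈ B.Pos) : B.posRep α = α := if_pos hα

theorem posRep_neg {α : V} (hα : α ∈ B.Pos) : B.posRep (-α) = α := by
  rw [posRep, if_neg (B.not_both α hα), neg_neg]

theorem posRep_refl_posRep_refl {α β : V} (hβ : β ∈ S.R) (hα : α ∈ B.Pos) :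
    B.posRep (S.refl β (B.posRep (S.refl β α))) = α := by
  by_cases h : S.refl β α ∈ B.Pos
  · rw [posRep_eq_self h, refl_refl hβ, posRep_eq_self hα]
  · rw [posRep.eq_1 B (S.refl β α), if_neg h, map_neg, refl_refl hβ, posRep_neg hα]

theorem sum_posRep_refl {M : Type*} [AddCommMonoid M] {β : V} (hβ : β ∈ S.R) (g : V → M) :
    ∑ α ∈ B.Pos, g (B.posRep (S.refl β α)) = ∑ α ∈ B.Pos, g α :=
  Finset.sum_nbij' (fun α => B.posRep (S.refl β α)) (fun α => B.posRep (S.refl β α))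
    (fun _ h => posRep_mem (refl_mem hβ (mem_R h))) (fun _ h => posRep_mem (refl_mem hβ (mem_R h)))
    (fun _ h => posRep_refl_posRep_refl hβ h) (fun _ h => posRep_refl_posRep_refl hβ h)
    (fun _ _ => rfl)

theorem sum_refl_of_even {M : Type*} [AddCommMonoid M] {β : V} (hβ : β ∈ S.R) (g : V → M)
    (hg : ∀ α ∈ S.R, g (-α) = g α) :
    ∑ α ∈ B.Pos, g (S.refl β α) = ∑ α ∈ B.Pos, g α := by
  rw [← sum_posRep_refl hβ g]
  refine Finset.sum_congr rfl fun α hα => ?_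
  unfold posRep
  split_ifs
  · rfl
  · rw [hg _ (refl_mem hβ (mem_R hα))]

theorem prod_posRep_refl {β : V} (hβ : β ∈ S.R) (f : V → ℝ) :
    ∏ α ∈ B.Pos, f (B.posRep (S.refl β α)) = ∏ α ∈ B.Pos, f α :=
  Finset.prod_nbij' (fun α => B.posRep (S.refl β α)) (fun α => B.posRep (S.refl β α))
    (fun _ h => posRep_mem (refl_mem hβ (mem_R h))) (fun _ h => posRep_mem (refl_mem hβ (mem_R h)))
    (fun _ h => posRep_refl_posRep_refl hβ h) (fun _ h => posRep_refl_posRep_refl hβ h)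
    (fun _ _ => rfl)

theorem eq_or_eq_neg_of_refl_eq_neg {α β : V} (hα : α ∈ S.R) (hβ : β ∈ S.R)
    (h : S.refl β α = -α) : α = β ∨ α = -β := by
  rw [refl_apply] at h
  have h2 : α = (S.I (S.coroot β) α / 2) • β := by
    have : (2 : ℝ) • α = S.I (S.coroot β) α • β := by
      linear_combination (norm := module) h
    rw [div_eq_inv_mul, mul_smul, ← this, smul_smul]; norm_num
  rcases S.reduced β hβ _ (h2 ▸ hα) with h3 | h3
  · left; rw [h2, h3, one_smul]
  · right; rw [h2, h3, neg_one_smul]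

theorem prod_sgn_refl {β : V} (hβ : β ∈ B.Pos) : ∏ α ∈ B.Pos, B.sgn (S.refl β α) = -1 := by
  rw [← Finset.mul_prod_erase _ _ hβ, refl_self (mem_R hβ)]
  have h1 : B.sgn (-β) = -1 := if_neg (B.not_both β hβ)
  have h2 : ∏ α ∈ B.Pos.erase β, B.sgn (S.refl β α) = 1 := by
    refine Finset.prod_involution (fun α _ => B.posRep (S.refl β α)) ?_ ?_ ?_ ?_
    · intro α hα
      have hα' := Finset.mem_of_mem_erase hα
      by_cases h : S.refl β α ∈ B.Pos
      · simp only [posRep_eq_self h, refl_refl (mem_R hβ)]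
        simp [sgn, h, hα']
      · have : B.posRep (S.refl β α) = -S.refl β α := if_neg h
        simp only [this, map_neg, refl_refl (mem_R hβ)]
        simp [sgn, h, B.not_both α hα']
    · intro α hα hne heq
      have hα' := Finset.mem_of_mem_erase hα
      have h : S.refl β α ∉ B.Pos := fun h => hne (if_pos h)
      have : B.posRep (S.refl β α) = -S.refl β α := if_neg h
      rw [this] at heq
      rcases eq_or_eq_neg_of_refl_eq_neg (mem_R hα') (mem_R hβ) (neg_eq_iff_eq_neg.1 heq) with h | h
      · exact Finset.ne_of_mem_erase hα h
      · exact B.not_both β hβ (h ▸ hα')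
    · intro α hα
      have hα' := Finset.mem_of_mem_erase hα
      refine Finset.mem_erase.2 ⟨fun h => ?_, posRep_mem (refl_mem (mem_R hβ) (mem_R hα'))⟩
      have h3 := posRep_refl_posRep_refl (B := B) (mem_R hβ) hα'
      rw [h, refl_self (mem_R hβ), posRep_neg hβ] at h3
      exact Finset.ne_of_mem_erase hα h3.symm
    · intro α hα
      exact posRep_refl_posRep_refl (mem_R hβ) (Finset.mem_of_mem_erase hα)
  rw [h1, h2]; norm_num

theorem prod_refl_of_odd {β : V} (hβ : β ∈ S.R) (f : V → ℝ) (hf : ∀ α ∈ S.R, f (-α) = -f α) :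
    ∏ α ∈ B.Pos, f (S.refl β α) = -∏ α ∈ B.Pos, f α := by
  wlog hpos : β ∈ B.Pos generalizing β
  · have := this (neg_mem hβ) ((B.mem_or_neg β hβ).resolve_left hpos)
    rwa [refl_neg] at this
  have h : ∀ α ∈ B.Pos, f (S.refl β α) = B.sgn (S.refl β α) * f (B.posRep (S.refl β α)) := by
    intro α hα
    unfold sgn posRep
    split_ifs
    · rw [one_mul]
    · rw [hf _ (refl_mem hβ (mem_R hα))]; ring
  rw [Finset.prod_congr rfl h, Finset.prod_mul_distrib, prod_sgn_refl hpos, prod_posRep_refl hβ]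
  ring

theorem exists_int_of_mem_corootLat {m α : V} (hm : m ∈ corootLat S) (hα : α ∈ S.R) :
    ∃ n : ℤ, S.I α m = n := by
  induction hm using AddSubgroup.closure_induction with
  | mem x hx =>
    obtain ⟨β, hβ, rfl⟩ := hx
    rw [S.symm]
    exact S.integral β hβ α hα
  | zero => exact ⟨0, by simp⟩
  | add x y _ _ hx hy =>
    obtain ⟨a, ha⟩ := hx; obtain ⟨b, hb⟩ := hy
    exact ⟨a + b, by push_cast; rw [map_add, ha, hb]⟩
  | neg x _ hx =>
    obtain ⟨a, ha⟩ := hx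
    exact ⟨-a, by push_cast; rw [map_neg, ha]⟩

theorem floor_eq {m α : V} (hm : m ∈ corootLat S) (hα : α ∈ S.R) :
    (⌊S.I α m⌋ : ℝ) = S.I α m := by
  obtain ⟨n, hn⟩ := exists_int_of_mem_corootLat hm hα
  rw [hn, Int.floor_intCast]

theorem floor_add {m m' α : V} (hm : m ∈ corootLat S) (hm' : m' ∈ corootLat S) (hα : α ∈ S.R) :
    ⌊S.I α (m + m')⌋ = ⌊S.I α m⌋ + ⌊S.I α m'⌋ := by
  have h : ((⌊S.I α (m + m')⌋ : ℤ) : ℝ) = ((⌊S.I α m⌋ + ⌊S.I α m'⌋ : ℤ) : ℝ) := by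
    push_cast
    rw [floor_eq hm hα, floor_eq hm' hα, floor_eq (add_mem hm hm') hα, map_add]
  exact_mod_cast h

theorem coroot_mem {β : V} (hβ : β ∈ S.R) : S.coroot β ∈ corootLat S :=
  AddSubgroup.subset_closure ⟨β, hβ, rfl⟩

theorem refl_mem_corootLat {β m : V} (hβ : β ∈ S.R) (hm : m ∈ corootLat S) :
    S.refl β m ∈ corootLat S := by
  induction hm using AddSubgroup.closure_induction with
  | mem x hx =>
    obtain ⟨γ, hγ, rfl⟩ := hx
    change S.refl β (S.coroot γ) ∈ _
    rw [refl_coroot hβ]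
    exact coroot_mem (refl_mem hβ hγ)
  | zero => rw [map_zero]; exact zero_mem _
  | add x y _ _ hx hy => rw [map_add]; exact add_mem hx hy
  | neg x _ hx => rw [map_neg]; exact NegMemClass.neg_mem hx

theorem even_sum_floor {m : V} (hm : m ∈ corootLat S) : Even (∑ α ∈ B.Pos, ⌊S.I α m⌋) := by
  have main : ∀ m ∈ corootLat S, ((∑ α ∈ B.Pos, ⌊S.I α m⌋ : ℤ) : ZMod 2) = 0 := by
    intro m hm
    induction hm using AddSubgroup.closure_induction with
    | mem x hx =>
      obtain ⟨β, hβ, rfl⟩ := hx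
      have hcor := coroot_mem hβ
      have hfl : ∀ α ∈ S.R, (⌊S.I α (S.refl β (S.coroot β))⌋ : ZMod 2) =
          (⌊S.I α (S.coroot β)⌋ : ZMod 2) := by
        intro α hα
        have h1 : ⌊S.I α (S.refl β (S.coroot β))⌋ = -⌊S.I α (S.coroot β)⌋ := by
          have : ((⌊S.I α (S.refl β (S.coroot β))⌋ : ℤ) : ℝ) = ((-⌊S.I α (S.coroot β)⌋ : ℤ) : ℝ) := by
            push_cast
            rw [floor_eq (refl_mem_corootLat hβ hcor) hα, floor_eq hcor hα, coroot, map_smul,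
              refl_self hβ, smul_neg, map_neg]
          exact_mod_cast this
        rw [h1]; push_cast; exact ZMod.neg_eq_self_mod_two _
      have hneg : ∀ α ∈ S.R, (⌊S.I (-α) (S.coroot β)⌋ : ZMod 2) =
          (⌊S.I α (S.coroot β)⌋ : ZMod 2) := by
        intro α hα
        have h1 : ⌊S.I (-α) (S.coroot β)⌋ = -⌊S.I α (S.coroot β)⌋ := by
          have : ((⌊S.I (-α) (S.coroot β)⌋ : ℤ) : ℝ) = ((-⌊S.I α (S.coroot β)⌋ : ℤ) : ℝ) := by
            push_cast
            rw [floor_eq hcor (RootSys.neg_mem hα), floor_eq hcor hα, map_neg, LinearMap.neg_apply]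
          exact_mod_cast this
        rw [h1]; push_cast; exact ZMod.neg_eq_self_mod_two _
      have hinv : ∀ α ∈ B.Pos, (⌊S.I (B.posRep (S.refl β α)) (S.coroot β)⌋ : ZMod 2) =
          (⌊S.I α (S.coroot β)⌋ : ZMod 2) := by
        intro α hα
        have h1 : (⌊S.I (S.refl β α) (S.coroot β)⌋ : ZMod 2) =
          (⌊S.I α (S.coroot β)⌋ : ZMod 2) := by
          rw [refl_adjoint hβ, hfl α (mem_R hα)]
        unfold posRep
        split_ifs
        · exact h1
        · rw [hneg _ (refl_mem hβ (mem_R hα)), h1]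
      rw [Int.cast_sum]
      refine Finset.sum_involution (fun α _ => B.posRep (S.refl β α)) ?_ ?_ ?_ ?_
      · intro α hα
        have := hinv α hα
        simp only [coroot] at this ⊢
        rw [this]
        exact CharTwo.add_self_eq_zero _
      · intro α hα hne heq
        apply hne
        change ((⌊S.I α (S.coroot β)⌋ : ℤ) : ZMod 2) = 0
        by_cases h : S.refl β α ∈ B.Pos
        · rw [posRep_eq_self h] at heq
          have h3 : S.I α (S.coroot β) = 0 := by
            rw [refl_apply, sub_eq_self, smul_eq_zero] at heq
            rw [S.symm]
            exact heq.resolve_right (ne_zero_of_mem hβ)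
          rw [h3]; simp
        · have h4 : B.posRep (S.refl β α) = -S.refl β α := if_neg h
          rw [h4] at heq
          rcases eq_or_eq_neg_of_refl_eq_neg (mem_R hα) hβ (neg_eq_iff_eq_neg.1 heq) with h | h
          · rw [h, S.symm, coroot_self hβ]; norm_num; rfl
          · rw [h, map_neg, LinearMap.neg_apply, S.symm, coroot_self hβ]; norm_num; rfl
      · intro α hα
        exact posRep_mem (refl_mem hβ (mem_R hα))
      · intro α hα
        exact posRep_refl_posRep_refl hβ hα
    | zero => simp
    | add x y hx' hy' hx hy =>
      rw [Finset.sum_congr rfl fun α hα => floor_add hx' hy' (mem_R hα), Finset.sum_add_distrib,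
        Int.cast_add, hx, hy, add_zero]
    | neg x hx' hx =>
      have h1 : ∀ α ∈ B.Pos, ⌊S.I α (-x)⌋ = -⌊S.I α x⌋ := by
        intro α hα
        have := floor_add hx' (NegMemClass.neg_mem hx') (mem_R hα)
        simp at this
        simp only [map_neg]
        omega
      rw [Finset.sum_congr rfl h1, Finset.sum_neg_distrib, Int.cast_neg, hx, neg_zero]
  exact (ZMod.intCast_eq_zero_iff_even).1 (main m hm)

end Base

namespace Base

open RootSys

variable {V : Type} [AddCommGroup V] [Module ℝ V] {S : RootSys V} (B : Base S)

/-- Nonnegative integer combinations of simple roots. -/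
def InCone (x : V) : Prop := ∃ c : V → ℕ, x = ∑ b ∈ B.Pi, (c b : ℝ) • b

variable {B}

theorem inCone_of_mem {α : V} (hα : α ∈ B.Pos) : B.InCone α := B.decomp α hα

theorem pi_mem_R {b : V} (hb : b ∈ B.Pi) : b ∈ S.R := mem_R (B.pi_sub hb)

theorem coeff_unique {c d : V → ℝ} (h : ∑ b ∈ B.Pi, c b • b = ∑ b ∈ B.Pi, d b • b) {b : V}
    (hb : b ∈ B.Pi) : c b = d b := by
  have h1 : ∑ x : {x // x ∈ B.Pi}, (c x - d x) • (x : V) = 0 := by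
    rw [Finset.sum_coe_sort B.Pi fun x => (c x - d x) • x]
    simp only [sub_smul, Finset.sum_sub_distrib, h, sub_self]
  exact sub_eq_zero.1 (Fintype.linearIndependent_iff.1 B.indep (fun x => c x - d x) h1 ⟨b, hb⟩)

theorem refl_mem_pos {b α : V} (hb : b ∈ B.Pi) (hα : α ∈ B.Pos) (hne : α ≠ b) :
    S.refl b α ∈ B.Pos := by
  by_contra hn
  have hneg : -S.refl b α ∈ B.Pos :=
    (B.mem_or_neg _ (refl_mem (pi_mem_R hb) (mem_R hα))).resolve_left hn
  obtain ⟨c, hc⟩ := B.decomp α hα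
  obtain ⟨d, hd⟩ := B.decomp _ hneg
  have key : ∀ b' ∈ B.Pi, b' ≠ b → c b' = 0 := by
    intro b' hb' hbb'
    have h1 : ∑ x ∈ B.Pi, ((c x : ℝ) + d x) • x =
        ∑ x ∈ B.Pi, (if x = b then S.I (S.coroot b) α else 0) • x := by
      simp only [add_smul, Finset.sum_add_distrib, ← hc, ← hd, ite_smul, zero_smul,
        Finset.sum_ite_eq', hb, if_true, refl_apply]
      abel
    have h2 := coeff_unique h1 hb'
    rw [if_neg hbb'] at h2
    have : c b' + d b' = 0 := by exact_mod_cast h2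
    omega
  have h3 : α = (c b : ℝ) • b := by
    conv_lhs => rw [hc]
    refine Finset.sum_eq_single_of_mem b hb fun b' hb' hbb' => ?_
    rw [key b' hb' hbb']; simp
  rcases S.reduced b (pi_mem_R hb) (c b : ℝ) (h3 ▸ mem_R hα) with h4 | h4
  · exact hne (by rw [h3, h4, one_smul])
  · have : (0 : ℝ) ≤ c b := Nat.cast_nonneg _
    linarith

theorem refl_weylVec {b : V} (hb : b ∈ B.Pi) : S.refl b (weylVec B) = weylVec B - b := by
  have hbP := B.pi_sub hb
  have h1 : ∑ α ∈ B.Pos.erase b, S.refl b α = ∑ α ∈ B.Pos.erase b, α := by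
    have hm : ∀ α ∈ B.Pos.erase b, S.refl b α ∈ B.Pos.erase b := by
      intro α hα
      rw [Finset.mem_erase] at hα ⊢
      refine ⟨fun h => ?_, refl_mem_pos hb hα.2 hα.1⟩
      have h2 := refl_refl (pi_mem_R hb) α
      rw [h, refl_self (pi_mem_R hb)] at h2
      exact B.not_both b hbP (h2 ▸ hα.2)
    exact Finset.sum_nbij' (S.refl b) (S.refl b) hm hm (fun α _ => refl_refl (pi_mem_R hb) α)
      (fun α _ => refl_refl (pi_mem_R hb) α) (fun _ _ => rfl)
  rw [weylVec, map_smul, map_sum, ← Finset.add_sum_erase _ _ hbP, h1,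
    ← Finset.add_sum_erase B.Pos (fun α => α) hbP, refl_self (pi_mem_R hb)]
  module

theorem coroot_weylVec {b : V} (hb : b ∈ B.Pi) : S.I (S.coroot b) (weylVec B) = 1 := by
  have h := refl_weylVec hb
  rw [refl_apply, sub_right_inj] at h
  have h2 : (S.I (S.coroot b) (weylVec B) - 1) • b = 0 := by rw [sub_smul, h, one_smul, sub_self]
  exact sub_eq_zero.1 ((smul_eq_zero.1 h2).resolve_right (ne_zero_of_mem (pi_mem_R hb)))

theorem weylVec_pi_pos {b : V} (hb : b ∈ B.Pi) : 0 < S.I (weylVec B) b := by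
  have h := coroot_weylVec hb
  have hp := norm_pos (pi_mem_R hb)
  rw [coroot_apply, S.symm b (weylVec B)] at h
  by_contra hn
  have : 2 / S.I b b * S.I (weylVec B) b ≤ 0 :=
    mul_nonpos_of_nonneg_of_nonpos (by positivity) (not_lt.1 hn)
  linarith

theorem InCone.apply_nonneg {x y : V} (hx : B.InCone x) (hy : ∀ b ∈ B.Pi, 0 ≤ S.I y b) :
    0 ≤ S.I y x := by
  obtain ⟨c, rfl⟩ := hx
  rw [map_sum]
  exact Finset.sum_nonneg fun b hb => by
    rw [map_smul, smul_eq_mul]; exact mul_nonneg (Nat.cast_nonneg _) (hy b hb)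

theorem InCone.weylVec_nonneg {x : V} (hx : B.InCone x) : 0 ≤ S.I (weylVec B) x :=
  hx.apply_nonneg fun _ hb => (weylVec_pi_pos hb).le

theorem InCone.weylVec_pos {x : V} (hx : B.InCone x) (h0 : x ≠ 0) : 0 < S.I (weylVec B) x := by
  refine hx.weylVec_nonneg.lt_of_ne fun h => h0 ?_
  obtain ⟨c, rfl⟩ := hx
  rw [map_sum, eq_comm, Finset.sum_eq_zero_iff_of_nonneg] at h
  · refine Finset.sum_eq_zero fun b hb => ?_
    have h1 := h b hb
    rw [map_smul, smul_eq_mul, mul_eq_zero] at h1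
    rw [h1.resolve_right (weylVec_pi_pos hb).ne', zero_smul]
  · intro b hb
    rw [map_smul, smul_eq_mul]
    exact mul_nonneg (Nat.cast_nonneg _) (weylVec_pi_pos hb).le

theorem weylVec_pos {α : V} (hα : α ∈ B.Pos) : 0 < S.I (weylVec B) α :=
  (inCone_of_mem hα).weylVec_pos (ne_zero_of_mem (mem_R hα))

theorem two_weylVec (x : V) : 2 * S.I (weylVec B) x = ∑ α ∈ B.Pos, S.I α x := by
  rw [weylVec, map_smul, map_sum, LinearMap.smul_apply, LinearMap.sum_apply, smul_eq_mul]
  ring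

theorem card_R : S.R.card = 2 * B.Pos.card := by
  have h : S.R = B.Pos ∪ B.Pos.image (fun α => -α) := by
    ext α
    simp only [Finset.mem_union, Finset.mem_image]
    constructor
    · intro hα
      rcases B.mem_or_neg α hα with h | h
      · exact Or.inl h
      · exact Or.inr ⟨-α, h, neg_neg α⟩
    · rintro (h | ⟨β, h, rfl⟩)
      · exact mem_R h
      · exact RootSys.neg_mem (mem_R h)
  rw [h, Finset.card_union_of_disjoint, Finset.card_image_of_injective _ neg_injective]
  · ring
  · rw [Finset.disjoint_left]
    intro α hα h
    obtain ⟨β, hβ, rfl⟩ := Finset.mem_image.1 h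
    exact B.not_both β hβ hα

end Base

namespace RootSys

variable {V : Type} [AddCommGroup V] [Module ℝ V] {S : RootSys V}

theorem coroot_neg (α : V) : S.coroot (-α) = -S.coroot α := by simp [coroot]

theorem coroot_add_coroot {α δ : V} (hα : α ∈ S.R) (hδ : δ ∈ S.R) (h : S.I α δ < 0) :
    S.coroot α + S.coroot δ = 0 ∨ ∃ β ∈ S.R, S.coroot α + S.coroot δ = S.coroot β := by
  have main : ∀ α ∈ S.R, ∀ δ ∈ S.R, S.I (S.coroot δ) α = -1 →
      S.coroot α + S.coroot δ = S.coroot (S.refl α δ) := by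
    intro α hα δ hδ h1
    rw [← refl_coroot hα, refl_apply, S.symm]
    have : S.I (S.coroot δ) (S.coroot α) • α = S.I (S.coroot δ) α • S.coroot α := by
      conv_lhs => rw [coroot.eq_1 S α]
      rw [map_smul, smul_eq_mul, coroot, coroot, smul_smul]
      ring_nf
    rw [this, h1]; module
  have hαp := norm_pos hα
  have hδp := norm_pos hδ
  have hneg : ∀ α ∈ S.R, ∀ δ ∈ S.R, S.I α δ < 0 → S.I (S.coroot δ) α ≠ -1 →
      S.I (S.coroot δ) α ≤ -2 := by
    intro α hα δ hδ h hne
    have hδp := norm_pos hδ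
    obtain ⟨n, hn⟩ := S.integral δ hδ α hα
    change S.I (S.coroot δ) α = n at hn
    have hlt : S.I (S.coroot δ) α < 0 := by
      rw [coroot_apply, S.symm δ α]; exact mul_neg_of_pos_of_neg (by positivity) h
    rw [hn] at hlt hne ⊢
    have h1 : n < 0 := by exact_mod_cast hlt
    have h2 : n ≠ -1 := by exact_mod_cast hne
    have : n ≤ -2 := by omega
    exact_mod_cast this
  by_cases h1 : S.I (S.coroot δ) α = -1
  · exact Or.inr ⟨_, refl_mem hα hδ, main α hα δ hδ h1⟩
  by_cases h2 : S.I (S.coroot α) δ = -1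
  · exact Or.inr ⟨_, refl_mem hδ hα, by rw [add_comm]; exact main δ hδ α hα h2⟩
  left
  have h3 := hneg α hα δ hδ h h1
  have h4 := hneg δ hδ α hα (by rwa [S.symm]) h2
  rw [coroot_apply, div_mul_eq_mul_div, div_le_iff₀ (by assumption)] at h3 h4
  have h5 : α + δ = 0 := by
    apply eq_zero_of_norm_le (S := S)
    simp only [map_add, LinearMap.add_apply]
    rw [S.symm δ α] at *
    linarith
  rw [eq_neg_of_add_eq_zero_right h5, coroot_neg, add_neg_cancel]

theorem exists_multiset_of_mem_corootLat {m : V} (hm : m ∈ corootLat S) :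
    ∃ s : Multiset V, (∀ α ∈ s, α ∈ S.R) ∧ (s.map S.coroot).sum = m := by
  induction hm using AddSubgroup.closure_induction with
  | mem x hx =>
    obtain ⟨β, hβ, rfl⟩ := hx
    exact ⟨{β}, by simpa using hβ, by simp [coroot]⟩
  | zero => exact ⟨0, by simp, by simp⟩
  | add x y _ _ hx hy =>
    obtain ⟨s, hs, rfl⟩ := hx; obtain ⟨t, ht, rfl⟩ := hy
    refine ⟨s + t, fun α hα => ?_, by simp⟩
    rcases Multiset.mem_add.1 hα with h | h
    · exact hs α h
    · exact ht α h
  | neg x _ hx =>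
    obtain ⟨s, hs, rfl⟩ := hx
    refine ⟨s.map Neg.neg, fun α hα => ?_, ?_⟩
    · obtain ⟨β, hβ, rfl⟩ := Multiset.mem_map.1 hα
      exact neg_mem (hs β hβ)
    · rw [Multiset.map_map, ← Multiset.sum_map_neg]
      simp [coroot_neg]

theorem exists_two_le_of_mem_corootLat {m : V} (hm : m ∈ corootLat S) (h0 : m ≠ 0) :
    ∃ α ∈ S.R, 2 ≤ S.I α m := by
  have hex : ∃ n, ∃ s : Multiset V, s.card = n ∧ (∀ α ∈ s, α ∈ S.R) ∧ (s.map S.coroot).sum = m := by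
    obtain ⟨s, hs⟩ := exists_multiset_of_mem_corootLat hm
    exact ⟨_, s, rfl, hs⟩
  obtain ⟨s, hcard, hsR, hsum⟩ := Nat.find_spec hex
  have hmin := fun k => Nat.find_min hex (m := k)
  rw [← hcard] at hmin
  clear hcard
  induction s using Multiset.induction_on with
  | empty => exact absurd hsum.symm (by simpa using h0)
  | cons α t _ =>
    have hα : α ∈ S.R := hsR α (Multiset.mem_cons_self α t)
    have htR : ∀ δ ∈ t, δ ∈ S.R := fun δ hδ => hsR δ (Multiset.mem_cons_of_mem hδ)
    refine ⟨α, hα, ?_⟩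
    have hpos : ∀ δ ∈ t, 0 ≤ S.I α δ := by
      intro δ hδ
      by_contra hlt
      obtain ⟨t', rfl⟩ := Multiset.exists_cons_of_mem hδ
      simp only [Multiset.map_cons, Multiset.sum_cons, ← add_assoc] at hsum
      have ht' : ∀ x ∈ t', x ∈ S.R := fun x hx => htR x (Multiset.mem_cons_of_mem hx)
      rcases coroot_add_coroot hα (htR δ hδ) (not_le.1 hlt) with h | ⟨β, hβ, h⟩
      · rw [h, zero_add] at hsum
        exact hmin t'.card (by simp only [Multiset.card_cons]; omega) ⟨t', rfl, ht', hsum⟩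
      · rw [h] at hsum
        refine hmin (t'.card + 1) (by simp only [Multiset.card_cons]; omega)
          ⟨β ::ₘ t', by simp, ?_, by simpa using hsum⟩
        intro x hx
        rcases Multiset.mem_cons.1 hx with rfl | hx
        · exact hβ
        · exact ht' x hx
    rw [← hsum, Multiset.map_cons, Multiset.sum_cons, map_add, S.symm, coroot_self hα]
    have : 0 ≤ S.I α (t.map S.coroot).sum := by
      rw [map_multiset_sum, Multiset.map_map]
      refine Multiset.sum_nonneg fun x hx => ?_
      obtain ⟨δ, hδ, rfl⟩ := Multiset.mem_map.1 hx
      have := norm_pos (htR δ hδ)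
      simp only [Function.comp, coroot, map_smul, smul_eq_mul]
      exact mul_nonneg (by positivity) (hpos δ hδ)
    linarith

end RootSys

namespace Base

open RootSys

variable {V : Type} [AddCommGroup V] [Module ℝ V] {S : RootSys V} {B : Base S}

/-- `θ` is the highest root, of squared length two, and `h` is the dual Coxeter number. -/
structure Highest (B : Base S) (θ : V) (h : ℝ) : Prop where
  mem : θ ∈ S.R
  high : ∀ α ∈ S.R, B.InCone (θ - α)
  norm : S.I θ θ = 2
  dual : h = 1 + S.I (weylVec B) θ

variable {θ : V} {h : ℝ}

namespace Highest

theorem coroot_eq (H : B.Highest θ h) : S.coroot θ = θ := by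
  rw [coroot, H.norm]; norm_num

theorem mem_pos (H : B.Highest θ h) : θ ∈ B.Pos := by
  rcases B.mem_or_neg θ H.mem with h1 | h1
  · exact h1
  · have h2 := weylVec_pos h1
    have h3 := (H.high _ (RootSys.neg_mem H.mem)).weylVec_nonneg
    rw [map_sub, map_neg] at h3
    rw [map_neg] at h2
    linarith

theorem apply_nonneg (H : B.Highest θ h) {α : V} (hα : α ∈ B.Pos) : 0 ≤ S.I α θ := by
  by_contra hlt
  rw [not_le] at hlt
  have h1 := (H.high _ (refl_mem (mem_R hα) H.mem)).weylVec_nonneg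
  have h2 := weylVec_pos hα
  have h3 := norm_pos (mem_R hα)
  rw [refl_apply, sub_sub_cancel, map_smul, smul_eq_mul, coroot_apply] at h1
  have : 2 / S.I α α * S.I α θ < 0 := mul_neg_of_pos_of_neg (by positivity) hlt
  nlinarith

theorem apply_eq (H : B.Highest θ h) {α : V} (hα : α ∈ B.Pos) (hne : α ≠ θ) :
    S.I α θ = 0 ∨ S.I α θ = 1 := by
  obtain ⟨n, hn⟩ := S.integral θ H.mem α (mem_R hα)
  change S.I (S.coroot θ) α = n at hn
  rw [H.coroot_eq] at hn
  have h0 := H.apply_nonneg hα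
  rw [S.symm] at h0 ⊢
  rw [hn] at h0 ⊢
  have h0' : 0 ≤ n := by exact_mod_cast h0
  by_cases h2 : n ≤ 1
  · have : n = 0 ∨ n = 1 := by omega
    exact_mod_cast this
  have h2' : (2 : ℝ) ≤ n := by exact_mod_cast (by omega : 2 ≤ n)
  have h3 := (H.high _ (RootSys.neg_mem (refl_mem H.mem (mem_R hα)))).weylVec_nonneg
  rw [refl_apply, H.coroot_eq, hn] at h3
  simp only [map_sub, map_neg, map_smul, smul_eq_mul] at h3
  have h4 := (H.high α (mem_R hα)).weylVec_pos (sub_ne_zero.2 hne.symm)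
  rw [map_sub] at h4
  have h5 := weylVec_pos H.mem_pos
  nlinarith

theorem pos (H : B.Highest θ h) : 0 < h := by
  have := weylVec_pos H.mem_pos
  linarith [H.dual]

theorem sum_smul (H : B.Highest θ h) (x : V) : ∑ α ∈ B.Pos, S.I α x • α = h • x := by
  set T : V →ₗ[ℝ] V := ∑ α ∈ B.Pos, (S.I α).smulRight α with hT
  have hTx : ∀ x, T x = ∑ α ∈ B.Pos, S.I α x • α := fun x => by
    simp [hT, LinearMap.sum_apply]
  have hcomm : ∀ β ∈ S.R, ∀ x, T (S.refl β x) = S.refl β (T x) := by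
    intro β hβ x
    rw [hTx, hTx, ← sum_refl_of_even hβ (fun α => S.I α x • α) (by simp), map_sum]
    refine Finset.sum_congr rfl fun α _ => ?_
    rw [map_smul, refl_refl hβ, refl_adjoint hβ]
  have hself : ∀ x y, S.I (T x) y = S.I x (T y) := by
    intro x y
    simp only [hTx, map_sum, map_smul, LinearMap.sum_apply, LinearMap.smul_apply, smul_eq_mul]
    refine Finset.sum_congr rfl fun α _ => ?_
    rw [S.symm x α]; ring
  have heig : ∀ β ∈ S.R, T β = (S.I (S.coroot β) (T β) / 2) • β := by
    intro β hβ
    have h1 := hcomm β hβ β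
    rw [refl_self hβ, map_neg, refl_apply] at h1
    have h2 : (2 : ℝ) • T β = S.I (S.coroot β) (T β) • β := by
      linear_combination (norm := module) -h1
    rw [div_eq_inv_mul, mul_smul, ← h2, smul_smul]; norm_num
  set e : V → ℝ := fun β => S.I (S.coroot β) (T β) / 2 with he
  have hθ : e θ = h := by
    have h1 : S.I θ (T θ) = 2 * h := by
      rw [hTx, map_sum]
      have h2 : ∀ α ∈ B.Pos.erase θ, S.I θ (S.I α θ • α) = S.I α θ := by
        intro α hα
        rw [Finset.mem_erase] at hα
        rw [map_smul, smul_eq_mul, S.symm θ α]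
        rcases H.apply_eq hα.2 hα.1 with h | h <;> rw [h] <;> norm_num
      have h3 := two_weylVec (B := B) θ
      rw [← Finset.add_sum_erase _ _ H.mem_pos] at h3
      rw [← Finset.add_sum_erase _ _ H.mem_pos, Finset.sum_congr rfl h2, map_smul, smul_eq_mul]
      rw [H.norm] at *
      linarith [H.dual]
    simp only [he, H.coroot_eq, h1]; ring
  have hirr := S.irred (S.R.filter fun α => e α = e θ) (S.R.filter fun α => e α ≠ e θ)
    (Finset.filter_union_filter_not_eq _ _) (by
      intro α hα β hβ
      rw [Finset.mem_filter] at hα hβ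
      have h1 := hself α β
      rw [heig α hα.1, heig β hβ.1, map_smul, map_smul, LinearMap.smul_apply, smul_eq_mul,
        smul_eq_mul, ← sub_eq_zero, ← sub_mul] at h1
      refine (mul_eq_zero.1 h1).resolve_left fun h2 => hβ.2 ?_
      rw [← hα.2]; exact (sub_eq_zero.1 h2).symm)
  have hall : ∀ α ∈ S.R, T α = h • α := by
    intro α hα
    rcases hirr with h1 | h1
    · exact absurd H.mem (Finset.filter_eq_empty_iff.1 h1 · rfl)
    · have h2 : e α = e θ := by
        by_contra hne
        exact Finset.filter_eq_empty_iff.1 h1 hα hne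
      rw [heig α hα, ← hθ, ← h2]
  have hx : x ∈ Submodule.span ℝ (S.R : Set V) := by rw [S.spanning]; trivial
  rw [← hTx]
  induction hx using Submodule.span_induction with
  | mem x hx => exact hall x hx
  | zero => simp
  | add x y _ _ hx hy => rw [map_add, hx, hy, smul_add]
  | smul c x _ hx => rw [map_smul, hx, smul_comm]

theorem sum_mul (H : B.Highest θ h) (x y : V) :
    ∑ α ∈ B.Pos, S.I α x * S.I α y = h * S.I x y := by
  have := congrArg (S.I y) (H.sum_smul x)
  rw [map_sum, map_smul, smul_eq_mul, S.symm y x] at this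
  rw [← this]
  exact Finset.sum_congr rfl fun α _ => by rw [map_smul, smul_eq_mul, S.symm y α]

theorem sum_norm [FiniteDimensional ℝ V] (H : B.Highest θ h) :
    ∑ α ∈ B.Pos, S.I α α = h * Module.finrank ℝ V := by
  have h1 : ∑ α ∈ B.Pos, (S.I α).smulRight α = h • (LinearMap.id : V →ₗ[ℝ] V) := by
    ext x; simpa [LinearMap.sum_apply] using H.sum_smul x
  have h2 := congrArg (LinearMap.trace ℝ V) h1
  simpa [LinearMap.trace_id] using h2

theorem norm_add_sub (H : B.Highest θ h) (m : V) :
    S.I (weylVec B + h • m) (weylVec B + h • m) - S.I (weylVec B) (weylVec B) =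
      h * ∑ α ∈ B.Pos, (S.I α m + S.I α m * S.I α m) := by
  rw [Finset.sum_add_distrib, H.sum_mul, ← two_weylVec]
  simp only [map_add, map_smul, LinearMap.add_apply, LinearMap.smul_apply, smul_eq_mul]
  rw [S.symm m (weylVec B)]; ring

theorem add_mul_self_nonneg {m α : V} (hm : m ∈ corootLat S) (hα : α ∈ S.R) :
    0 ≤ S.I α m + S.I α m * S.I α m := by
  obtain ⟨n, hn⟩ := exists_int_of_mem_corootLat hm hα
  rw [hn]
  have : 0 ≤ n + n * n := by
    rcases le_or_gt 0 n with h | h <;> nlinarith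
  exact_mod_cast this

theorem norm_lt (H : B.Highest θ h) {m : V} (hm : m ∈ corootLat S) (h0 : m ≠ 0) :
    S.I (weylVec B) (weylVec B) < S.I (weylVec B + h • m) (weylVec B + h • m) := by
  rw [← sub_pos, H.norm_add_sub]
  refine mul_pos H.pos (Finset.sum_pos' (fun α hα => add_mul_self_nonneg hm (mem_R hα)) ?_)
  obtain ⟨α, hα, h2⟩ := exists_two_le_of_mem_corootLat hm h0
  rcases B.mem_or_neg α hα with h1 | h1
  · exact ⟨α, h1, by nlinarith⟩
  · exact ⟨-α, h1, by rw [map_neg, LinearMap.neg_apply]; nlinarith⟩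

theorem eq_zero_of_dominant (H : B.Highest θ h) {x : V} (hx : ∀ b ∈ B.Pi, 0 ≤ S.I x b)
    (hθ : S.I x θ ≤ 0) : x = 0 := by
  have key : ∀ α ∈ S.R, S.I x α ≤ 0 := by
    intro α hα
    have := (H.high α hα).apply_nonneg hx
    rw [map_sub] at this
    linarith
  refine eq_zero_of_orthogonal (S := S) fun α hα => le_antisymm (key α hα) ?_
  have := key _ (RootSys.neg_mem hα)
  rw [map_neg] at this
  linarith

end Highest

end Base

namespace Base

open RootSys

variable {V : Type} [AddCommGroup V] [Module ℝ V] {S : RootSys V} (B : Base S)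

/-- Extension of an integer vector on the positive roots to all roots, such that the half-integer
shift is odd. -/
noncomputable def extend (k : {α // α ∈ B.Pos} → ℤ) (α : V) : ℤ :=
  if h : α ∈ B.Pos then k ⟨α, h⟩ else if h' : -α ∈ B.Pos then -1 - k ⟨-α, h'⟩ else 0

/-- The action of a reflection on integer vectors indexed by positive roots. -/
noncomputable def reflIdx (β : V) (k : {α // α ∈ B.Pos} → ℤ) : {α // α ∈ B.Pos} → ℤ :=
  fun α => B.extend k (S.refl β α)

/-- The action of a translation on integer vectors indexed by positive roots. -/
noncomputable def transIdx (m : V) (k : {α // α ∈ B.Pos} → ℤ) : {α // α ∈ B.Pos} → ℤ :=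
  fun α => k α + ⌊S.I α m⌋

/-- The weight `∑ (k_α + 1/2) α`. -/
noncomputable def wt (k : {α // α ∈ B.Pos} → ℤ) : V := ∑ α, halfShift k α • (α : V)

/-- The total weight of the integer vectors with a given image. -/
noncomputable def mass (w : ℤ → ℝ) (x : V) : ℝ := ∑' k, if B.wt k = x then prodWt w k else 0

variable {B}

theorem extend_coe (k : {α // α ∈ B.Pos} → ℤ) (α : {α // α ∈ B.Pos}) : B.extend k α = k α :=
  dif_pos α.2

theorem extend_neg (k : {α // α ∈ B.Pos} → ℤ) {α : V} (hα : α ∈ S.R) :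
    B.extend k (-α) = -1 - B.extend k α := by
  unfold extend
  by_cases h : α ∈ B.Pos
  · rw [dif_neg (B.not_both α h), dif_pos h, dif_pos (by rwa [neg_neg])]
    congr 2
    simp
  · have h' := (B.mem_or_neg α hα).resolve_left h
    rw [dif_neg h, dif_pos h', dif_pos h']
    ring

theorem extend_reflIdx {β : V} (hβ : β ∈ S.R) (k : {α // α ∈ B.Pos} → ℤ) {α : V} (hα : α ∈ S.R) :
    B.extend (B.reflIdx β k) α = B.extend k (S.refl β α) := by
  rcases B.mem_or_neg α hα with h | h
  · exact extend_coe _ ⟨α, h⟩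
  · have h1 : B.extend (B.reflIdx β k) (-α) = B.extend k (S.refl β (-α)) := extend_coe _ ⟨-α, h⟩
    rw [extend_neg _ hα, map_neg, extend_neg _ (refl_mem hβ hα)] at h1
    omega

theorem reflIdx_reflIdx {β : V} (hβ : β ∈ S.R) (k : {α // α ∈ B.Pos} → ℤ) :
    B.reflIdx β (B.reflIdx β k) = k := by
  funext α
  rw [reflIdx, extend_reflIdx hβ _ (refl_mem hβ (mem_R α.2)), refl_refl hβ, extend_coe]

theorem wt_eq (k : {α // α ∈ B.Pos} → ℤ) :
    B.wt k = ∑ α ∈ B.Pos, ((B.extend k α : ℝ) + 1 / 2) • α := by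
  rw [wt, ← Finset.sum_coe_sort B.Pos fun α => ((B.extend k α : ℝ) + 1 / 2) • α]
  exact Finset.sum_congr rfl fun α _ => by rw [halfShift, extend_coe]

theorem prodWt_eq (w : ℤ → ℝ) (k : {α // α ∈ B.Pos} → ℤ) :
    prodWt w k = ∏ α ∈ B.Pos, w (B.extend k α) := by
  rw [prodWt, ← Finset.prod_coe_sort B.Pos fun α => w (B.extend k α)]
  exact Finset.prod_congr rfl fun α _ => by rw [extend_coe]

theorem wt_reflIdx {β : V} (hβ : β ∈ S.R) (k : {α // α ∈ B.Pos} → ℤ) :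
    B.wt (B.reflIdx β k) = S.refl β (B.wt k) := by
  rw [wt_eq, wt_eq, map_sum, ← sum_refl_of_even hβ]
  · refine Finset.sum_congr rfl fun α hα => ?_
    rw [map_smul, extend_reflIdx hβ _ (refl_mem hβ (mem_R hα)), refl_refl hβ]
  · intro α hα
    rw [extend_neg _ hα]
    push_cast
    module

theorem prodWt_reflIdx {w : ℤ → ℝ} (hw : OddWeight w) {β : V} (hβ : β ∈ S.R)
    (k : {α // α ∈ B.Pos} → ℤ) : prodWt w (B.reflIdx β k) = -prodWt w k := by
  rw [prodWt_eq, prodWt_eq, ← prod_refl_of_odd hβ (fun α => w (B.extend k α))]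
  · exact Finset.prod_congr rfl fun α hα => by rw [extend_reflIdx hβ _ (mem_R hα)]
  · intro α hα
    rw [extend_neg _ hα, hw.odd]

theorem mass_refl {w : ℤ → ℝ} (hw : OddWeight w) {β : V} (hβ : β ∈ S.R) (x : V) :
    B.mass w (S.refl β x) = -B.mass w x := by
  have hinv : Function.Involutive (B.reflIdx β) := reflIdx_reflIdx hβ
  rw [mass, ← (hinv.toPerm _).tsum_eq, mass, ← tsum_neg]
  refine tsum_congr fun k => ?_
  simp only [Function.Involutive.coe_toPerm, wt_reflIdx hβ, prodWt_reflIdx hw hβ]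
  have : S.refl β (B.wt k) = S.refl β x ↔ B.wt k = x :=
    ⟨fun h => by rw [← refl_refl hβ (B.wt k), h, refl_refl hβ], fun h => by rw [h]⟩
  simp only [this]
  split_ifs <;> simp

theorem exists_of_mass_ne_zero {w : ℤ → ℝ} {x : V} (h : B.mass w x ≠ 0) :
    ∃ k, B.wt k = x ∧ prodWt w k ≠ 0 := by
  by_contra! hn
  apply h
  rw [mass, tsum_congr (g := fun _ => 0), tsum_zero]
  intro k
  split_ifs with hk
  · exact hn k hk
  · rfl

theorem wt_sub_weylVec (k : {α // α ∈ B.Pos} → ℤ) :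
    B.wt k - weylVec B = ∑ α : {α // α ∈ B.Pos}, (k α : ℝ) • (α : V) := by
  rw [wt, weylVec, ← Finset.sum_coe_sort B.Pos fun α => α, Finset.smul_sum,
    ← Finset.sum_sub_distrib]
  refine Finset.sum_congr rfl fun α _ => ?_
  rw [halfShift, ← sub_smul]; norm_num

theorem exists_int_of_mass_ne_zero {w : ℤ → ℝ} {x : V} (h : B.mass w x ≠ 0) {β : V}
    (hβ : β ∈ S.R) : ∃ n : ℤ, S.I (S.coroot β) (x - weylVec B) = n := by
  obtain ⟨k, rfl, -⟩ := exists_of_mass_ne_zero h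
  have h1 : ∀ α : {α // α ∈ B.Pos}, ∃ n : ℤ, S.I (S.coroot β) α = n :=
    fun α => S.integral β hβ α (mem_R α.2)
  choose n hn using h1
  refine ⟨∑ α, k α * n α, ?_⟩
  rw [wt_sub_weylVec, map_sum]
  push_cast
  exact Finset.sum_congr rfl fun α _ => by rw [map_smul, hn, smul_eq_mul]

theorem coroot_ne_zero_of_mass_ne_zero {w : ℤ → ℝ} (hw : OddWeight w) {x : V}
    (h : B.mass w x ≠ 0) {β : V} (hβ : β ∈ S.R) : S.I (S.coroot β) x ≠ 0 := by
  intro h0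
  have h1 := mass_refl (B := B) hw hβ x
  rw [refl_apply, h0, zero_smul, sub_zero] at h1
  exact h (by linarith)

theorem transIdx_add {m m' : V} (hm : m ∈ corootLat S) (hm' : m' ∈ corootLat S)
    (k : {α // α ∈ B.Pos} → ℤ) : B.transIdx (m + m') k = B.transIdx m' (B.transIdx m k) := by
  funext α
  simp only [transIdx, floor_add hm hm' (mem_R α.2)]
  ring

theorem transIdx_zero (k : {α // α ∈ B.Pos} → ℤ) : B.transIdx 0 k = k := by
  funext α; simp [transIdx]

theorem Highest.wt_transIdx {θ : V} {h : ℝ} (H : B.Highest θ h) {m : V} (hm : m ∈ corootLat S)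
    (k : {α // α ∈ B.Pos} → ℤ) : B.wt (B.transIdx m k) = B.wt k + h • m := by
  rw [wt, wt, ← H.sum_smul, ← Finset.sum_coe_sort B.Pos fun α => S.I α m • α,
    ← Finset.sum_add_distrib]
  refine Finset.sum_congr rfl fun α _ => ?_
  rw [halfShift, halfShift, transIdx, ← add_smul]
  push_cast
  rw [floor_eq hm (mem_R α.2)]
  ring_nf

theorem thetaWt_add {q : ℝ} (hq : 0 < q) (k n : ℤ) :
    thetaWt q (k + n) = (-1) ^ n * thetaWt q k * q ^ ((n : ℝ) * ((k : ℝ) + 1 / 2) + (n : ℝ) * n / 2) := by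
  rw [thetaWt, thetaWt, zpow_add₀ (by norm_num)]
  have : (((k + n : ℤ) : ℝ) + 1 / 2) ^ 2 / 2 =
    ((k : ℝ) + 1 / 2) ^ 2 / 2 + ((n : ℝ) * ((k : ℝ) + 1 / 2) + (n : ℝ) * n / 2) := by
    push_cast; ring
  rw [this, Real.rpow_add hq]
  ring

theorem Highest.prodWt_transIdx {θ : V} {h : ℝ} (H : B.Highest θ h) {m : V}
    (hm : m ∈ corootLat S) {q : ℝ} (hq : 0 < q) (k : {α // α ∈ B.Pos} → ℤ) :
    prodWt (thetaWt q) (B.transIdx m k) = prodWt (thetaWt q) k *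
      q ^ ((S.I (B.wt k + h • m) (B.wt k + h • m) - S.I (B.wt k) (B.wt k)) / (2 * h)) := by
  have hh := H.pos.ne'
  have hexp : (S.I (B.wt k + h • m) (B.wt k + h • m) - S.I (B.wt k) (B.wt k)) / (2 * h) =
      ∑ α : {α // α ∈ B.Pos}, ((⌊S.I α m⌋ : ℝ) * ((k α : ℝ) + 1 / 2) +
        (⌊S.I α m⌋ : ℝ) * ⌊S.I α m⌋ / 2) := by
    rw [Finset.sum_add_distrib, ← Finset.sum_div]
    have h1 : ∑ α : {α // α ∈ B.Pos}, (⌊S.I α m⌋ : ℝ) * ((k α : ℝ) + 1 / 2) = S.I m (B.wt k) := by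
      rw [wt, map_sum]
      refine Finset.sum_congr rfl fun α _ => ?_
      rw [map_smul, smul_eq_mul, floor_eq hm (mem_R α.2), S.symm m, halfShift]
      ring
    have h2 : ∑ α : {α // α ∈ B.Pos}, (⌊S.I α m⌋ : ℝ) * ⌊S.I α m⌋ = h * S.I m m := by
      rw [← H.sum_mul, ← Finset.sum_coe_sort B.Pos fun α => S.I α m * S.I α m]
      refine Finset.sum_congr rfl fun α _ => ?_
      rw [floor_eq hm (mem_R α.2)]
    rw [h1, h2]
    simp only [map_add, map_smul, LinearMap.add_apply, LinearMap.smul_apply, smul_eq_mul]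
    rw [S.symm (B.wt k) m]
    field_simp
    ring
  have hsign : ∏ α : {α // α ∈ B.Pos}, (-1 : ℝ) ^ ⌊S.I α m⌋ = 1 := by
    rw [Finset.prod_coe_sort B.Pos fun α => (-1 : ℝ) ^ ⌊S.I α m⌋]
    have h3 : ∀ s : Finset V, ∏ α ∈ s, (-1 : ℝ) ^ ⌊S.I α m⌋ = (-1) ^ ∑ α ∈ s, ⌊S.I α m⌋ := by
      intro s
      induction s using Finset.induction_on with
      | empty => simp
      | insert a s ha ih =>
        rw [Finset.prod_insert ha, Finset.sum_insert ha, zpow_add₀ (by norm_num), ih]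
    rw [h3, (even_sum_floor hm).neg_one_zpow]
  rw [hexp, Real.rpow_sum_of_pos hq, prodWt, prodWt, ← Finset.prod_mul_distrib]
  refine Eq.trans ?_ ((congrArg₂ (· * ·) hsign rfl).trans (one_mul _))
  rw [← Finset.prod_mul_distrib]
  refine Finset.prod_congr rfl fun α _ => ?_
  rw [transIdx, thetaWt_add hq]
  ring

theorem Highest.mass_add {θ : V} {h : ℝ} (H : B.Highest θ h) {m : V}
    (hm : m ∈ corootLat S) {q : ℝ} (hq : 0 < q) (x : V) :
    B.mass (thetaWt q) (x + h • m) = B.mass (thetaWt q) x *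
      q ^ ((S.I (x + h • m) (x + h • m) - S.I x x) / (2 * h)) := by
  let e : ({α // α ∈ B.Pos} → ℤ) ≃ ({α // α ∈ B.Pos} → ℤ) :=
    ⟨B.transIdx m, B.transIdx (-m),
      fun k => by rw [← transIdx_add hm (NegMemClass.neg_mem hm), add_neg_cancel, transIdx_zero],
      fun k => by rw [← transIdx_add (NegMemClass.neg_mem hm) hm, neg_add_cancel, transIdx_zero]⟩
  rw [mass, ← e.tsum_eq, mass, ← tsum_mul_right]
  refine tsum_congr fun k => ?_
  change (if B.wt (B.transIdx m k) = _ then prodWt _ (B.transIdx m k) else 0) = _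
  rw [H.wt_transIdx hm, H.prodWt_transIdx hm hq, add_left_inj]
  split_ifs with hk
  · rw [hk]
  · rw [zero_mul]

end Base

theorem descent {X : Type*} (N : X → ℝ) (hN : ∀ x, 0 ≤ N x) {δ : ℝ} (hδ : 0 < δ) (A C : X → Prop)
    (step : ∀ x, A x → C x ∨ ∃ y, A y ∧ N y ≤ N x - δ ∧ (C y → C x)) (x : X) (hx : A x) : C x := by
  have main : ∀ n : ℕ, ∀ x, A x → N x < n * δ → C x := by
    intro n
    induction n with
    | zero => intro x _ h; have := hN x; norm_num at h; linarith
    | succ n ih =>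
      intro x hx h
      rcases step x hx with h1 | ⟨y, hy, hyN, hC⟩
      · exact h1
      · refine hC (ih y hy ?_)
        push_cast at h
        linarith
  obtain ⟨n, hn⟩ := exists_nat_gt (N x / δ)
  exact main n x hx ((div_lt_iff₀ hδ).1 hn)

namespace Base

open RootSys

variable {V : Type} [AddCommGroup V] [Module ℝ V] {S : RootSys V} {B : Base S}

theorem exists_le_norm (B : Base S) : ∃ δ : ℝ, 0 < δ ∧ δ ≤ 2 ∧ ∀ b ∈ B.Pi, δ ≤ S.I b b := by
  have main : ∀ s ⊆ B.Pi, ∃ δ : ℝ, 0 < δ ∧ δ ≤ 2 ∧ ∀ b ∈ s, δ ≤ S.I b b := by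
    intro s
    induction s using Finset.induction_on with
    | empty => exact fun _ => ⟨2, by norm_num, le_rfl, by simp⟩
    | insert a s _ ih =>
      intro hs
      obtain ⟨δ, h0, h2, hδ⟩ := ih ((Finset.subset_insert _ _).trans hs)
      refine ⟨min δ (S.I a a), lt_min h0 (norm_pos (pi_mem_R (hs (Finset.mem_insert_self a s)))),
        (min_le_left _ _).trans h2, fun b hb => ?_⟩
      rcases Finset.mem_insert.1 hb with rfl | hb
      · exact min_le_right _ _
      · exact (min_le_left _ _).trans (hδ b hb)
  exact main _ subset_rfl

/-- The squared distance to the Weyl vector. -/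
noncomputable def dist (B : Base S) (x : V) : ℝ := S.I (x - weylVec B) (x - weylVec B)

theorem dist_nonneg (x : V) : 0 ≤ B.dist x := by
  by_cases h : x - weylVec B = 0
  · rw [dist, h]; simp
  · exact (S.posdef _ h).le

theorem dist_refl {b : V} (hb : b ∈ B.Pi) {x : V} (h : S.I (S.coroot b) x ≤ -1) :
    B.dist (S.refl b x) ≤ B.dist x - S.I b b := by
  have hbR := pi_mem_R hb
  have h1 := refl_isometry hbR x x
  have hp := norm_pos hbR
  have h2 : 2 * S.I (weylVec B) b = S.I b b := by
    have := coroot_weylVec hb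
    rw [coroot_apply, S.symm b (weylVec B)] at this
    field_simp at this
    exact this
  have h3 : S.I (S.refl b x) (weylVec B) =
      S.I x (weylVec B) - S.I (S.coroot b) x * S.I (weylVec B) b := by
    rw [refl_apply, map_sub, map_smul, LinearMap.sub_apply, LinearMap.smul_apply, smul_eq_mul,
      S.symm b (weylVec B)]
  simp only [dist, map_sub, LinearMap.sub_apply]
  rw [h1, S.symm (weylVec B), S.symm (weylVec B) x, h3]
  nlinarith

theorem mass_descent {w : ℤ → ℝ} (hw : OddWeight w) (C : V → Prop)
    (hrefl : ∀ b ∈ B.Pi, ∀ x, C (S.refl b x) → C x)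
    (hterm : ∀ x, B.mass w x ≠ 0 → (∀ b ∈ B.Pi, 0 ≤ S.I (x - weylVec B) b) →
      C x ∨ ∃ y, B.mass w y ≠ 0 ∧ B.dist y ≤ B.dist x - 2 ∧ (C y → C x))
    (x : V) (hx : B.mass w x ≠ 0) : C x := by
  obtain ⟨δ, h0, h2, hδ⟩ := B.exists_le_norm
  refine descent B.dist dist_nonneg h0 (fun x => B.mass w x ≠ 0) C (fun x hx => ?_) x hx
  by_cases hdom : ∀ b ∈ B.Pi, 0 ≤ S.I (x - weylVec B) b
  · rcases hterm x hx hdom with h | ⟨y, hy, hyd, hC⟩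
    · exact Or.inl h
    · exact Or.inr ⟨y, hy, by linarith, hC⟩
  · push Not at hdom
    obtain ⟨b, hb, hlt⟩ := hdom
    right
    have hbR := pi_mem_R hb
    refine ⟨S.refl b x, by rw [mass_refl hw hbR]; exact neg_ne_zero.2 hx, ?_, hrefl b hb x⟩
    have h3 : S.I (S.coroot b) x ≤ -1 := by
      obtain ⟨n, hn⟩ := exists_int_of_mass_ne_zero hx hbR
      have hp := norm_pos hbR
      have h4 : S.I (S.coroot b) (x - weylVec B) < 0 := by
        rw [coroot_apply, S.symm b (x - _)]
        exact mul_neg_of_pos_of_neg (by positivity) hlt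
      have h5 := coroot_ne_zero_of_mass_ne_zero hw hx hbR
      rw [map_sub, coroot_weylVec hb] at hn h4
      have h6 : S.I (S.coroot b) x = ((n + 1 : ℤ) : ℝ) := by push_cast; linarith
      rw [h6] at h4 h5 ⊢
      have h7 : n < 0 := by
        have : (n : ℝ) < 0 := by push_cast at h4; linarith
        exact_mod_cast this
      have h8 : n + 1 ≠ 0 := by exact_mod_cast h5
      have : n + 1 ≤ -1 := by omega
      exact_mod_cast this
    have := dist_refl hb h3
    have := hδ b hb
    linarith

theorem thetaWt_oddWeight {q : ℝ} (hq0 : 0 < q) (hq1 : q < 1) : OddWeight (thetaWt q) :=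
  ⟨thetaWt_neg q, summable_abs_thetaWt q hq0 hq1⟩

theorem Highest.eq_of_mass_ne_zero {θ : V} {h : ℝ} (H : B.Highest θ h) {q : ℝ} (hq0 : 0 < q)
    (hq1 : q < 1) (T : V → ℝ) (hrefl : ∀ β ∈ S.R, ∀ x, T (S.refl β x) = T x)
    (htrans : ∀ m ∈ corootLat S, ∀ x, T (x + h • m) = T x) (x : V)
    (hx : B.mass (thetaWt q) x ≠ 0) : T x = T (weylVec B) := by
  have hw := thetaWt_oddWeight hq0 hq1
  have hθM : θ ∈ corootLat S := H.coroot_eq ▸ coroot_mem H.mem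
  refine mass_descent hw (fun x => T x = T (weylVec B))
    (fun b hb x hx => by rwa [hrefl b (pi_mem_R hb)] at hx) (fun x hx hdom => ?_) x hx
  obtain ⟨n, hn⟩ := exists_int_of_mass_ne_zero hx H.mem
  rw [H.coroot_eq, S.symm] at hn
  by_cases hn0 : n ≤ 0
  · left
    have := H.eq_zero_of_dominant hdom (by rw [hn]; exact_mod_cast hn0)
    rw [sub_eq_zero.1 this]
  right
  have hmass : B.mass (thetaWt q) (S.refl θ x + h • θ) ≠ 0 := by
    rw [H.mass_add hθM hq0, mass_refl hw H.mem]
    exact mul_ne_zero (neg_ne_zero.2 hx) (Real.rpow_pos_of_pos hq0 _).ne'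
  have hxθ : S.I θ x = n - 1 + h := by
    rw [map_sub, LinearMap.sub_apply] at hn
    rw [S.symm θ x]
    linarith [H.dual]
  have href : S.refl θ x + h • θ = x + (1 - (n : ℝ)) • θ := by
    rw [refl_apply, H.coroot_eq, hxθ]; module
  have hn1 : n ≠ 1 := by
    rintro rfl
    have h1 := H.mass_add (q := q) hθM hq0 (S.refl θ x)
    rw [href, refl_isometry H.mem, mass_refl hw H.mem] at h1
    norm_num at h1
    exact hx (by linarith)
  have hn2 : (2 : ℝ) ≤ n := by exact_mod_cast (by omega : 2 ≤ n)
  refine ⟨_, hmass, ?_, fun hC => ?_⟩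
  · rw [href, dist, dist, add_sub_right_comm]
    simp only [map_add, map_smul, LinearMap.add_apply, LinearMap.smul_apply, smul_eq_mul]
    rw [S.symm θ, hn, H.norm]
    nlinarith
  · rwa [htrans θ hθM, hrefl θ H.mem] at hC

/-- The polynomial `∏ (α, x)` over the positive roots. -/
noncomputable def rootProd (B : Base S) (x : V) : ℝ := ∏ α ∈ B.Pos, S.I α x

theorem rootProd_refl {β : V} (hβ : β ∈ S.R) (x : V) :
    B.rootProd (S.refl β x) = -B.rootProd x := by
  rw [rootProd, rootProd, ← prod_refl_of_odd hβ (fun α => S.I α x)]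
  · exact Finset.prod_congr rfl fun α _ => by rw [refl_adjoint hβ]
  · intro α _; rw [map_neg, LinearMap.neg_apply]

theorem rootProd_weylVec_pos : 0 < B.rootProd (weylVec B) :=
  Finset.prod_pos fun α hα => by rw [S.symm]; exact weylVec_pos hα

/-- The odd weight supported on `±1/2`. -/
noncomputable def signWt (k : ℤ) : ℝ := if k = 0 then 1 else if k = -1 then -1 else 0

theorem signWt_eq_zero {k : ℤ} (h : k ∉ ({0, -1} : Finset ℤ)) : signWt k = 0 := by
  simp only [Finset.mem_insert, Finset.mem_singleton, not_or] at h
  rw [signWt, if_neg h.1, if_neg h.2]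

theorem signWt_oddWeight : OddWeight signWt where
  odd k := by
    unfold signWt
    by_cases h0 : k = 0
    · simp [h0]
    · by_cases h1 : k = -1
      · simp [h1]
      · rw [if_neg (by omega), if_neg (by omega), if_neg h0, if_neg h1, neg_zero]
  summable n := summable_of_ne_finset_zero (s := {0, -1}) fun k hk => by
    rw [signWt_eq_zero hk, abs_zero, zero_mul]

theorem moment_signWt (n : ℕ) (hn : Odd n) : moment signWt n = 2 * (1 / 2) ^ n := by
  rw [moment, tsum_eq_sum (s := {0, -1}) fun k hk => by rw [signWt_eq_zero hk, zero_mul],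
    Finset.sum_pair (by norm_num)]
  have : ((-1 : ℤ) : ℝ) + 1 / 2 = -(1 / 2) := by norm_num
  rw [this, hn.neg_pow]
  simp [signWt]
  ring

theorem exists_subset_of_mass_signWt {x : V} (hx : B.mass signWt x ≠ 0) :
    B.InCone (weylVec B - x) := by
  obtain ⟨k, rfl, hk⟩ := exists_of_mass_ne_zero hx
  have hk' : ∀ α : {α // α ∈ B.Pos}, k α = 0 ∨ k α = -1 := by
    intro α
    by_contra hn
    refine (Finset.prod_ne_zero_iff.1 hk α (Finset.mem_univ α)) (signWt_eq_zero ?_)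
    simpa using hn
  choose c hc using fun α : {α // α ∈ B.Pos} => B.decomp α α.2
  refine ⟨fun b => ∑ α, (-k α).toNat * c α b, ?_⟩
  rw [← neg_sub, wt_sub_weylVec, ← Finset.sum_neg_distrib]
  push_cast
  simp only [Finset.sum_smul]
  rw [Finset.sum_comm]
  refine Finset.sum_congr rfl fun α _ => ?_
  simp only [mul_smul]
  rw [← Finset.smul_sum, ← hc]
  rcases hk' α with h | h <;> simp [h]

theorem mass_signWt_weylVec : B.mass signWt (weylVec B) = 1 := by
  rw [mass, tsum_eq_single 0]
  · rw [if_pos]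
    · simp [prodWt, signWt]
    · rw [← sub_eq_zero, wt_sub_weylVec]; simp
  · intro k hk
    split_ifs with h
    · by_contra hne
      have hk' : ∀ α : {α // α ∈ B.Pos}, (k α : ℝ) ≤ 0 := by
        intro α
        by_contra hn
        refine (Finset.prod_ne_zero_iff.1 hne α (Finset.mem_univ α)) (signWt_eq_zero fun h => hn ?_)
        simp at h
        rcases h with h | h <;> simp [h]
      rw [← sub_eq_zero, wt_sub_weylVec] at h
      have h1 := congrArg (S.I (weylVec B)) h
      rw [map_sum, map_zero, Finset.sum_eq_zero_iff_of_nonpos] at h1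
      · apply hk
        funext α
        have h2 := h1 α (Finset.mem_univ α)
        rw [map_smul, smul_eq_mul] at h2
        have := (mul_eq_zero.1 h2).resolve_right (weylVec_pos α.2).ne'
        exact_mod_cast this
      · intro α _
        rw [map_smul, smul_eq_mul]
        exact mul_nonpos_of_nonpos_of_nonneg (hk' α) (weylVec_pos α.2).le
    · rfl

theorem mass_signWt_spec (x : V) (hx : B.mass signWt x ≠ 0) :
    S.I x x = S.I (weylVec B) (weylVec B) ∧
      B.mass signWt x * B.rootProd x = B.rootProd (weylVec B) := by
  refine mass_descent signWt_oddWeight (fun x => S.I x x = S.I (weylVec B) (weylVec B) ∧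
      B.mass signWt x * B.rootProd x = B.rootProd (weylVec B)) ?_ ?_ x hx
  · rintro b hb x ⟨h1, h2⟩
    rw [refl_isometry (pi_mem_R hb)] at h1
    rw [mass_refl signWt_oddWeight (pi_mem_R hb), rootProd_refl (pi_mem_R hb), neg_mul_neg] at h2
    exact ⟨h1, h2⟩
  · intro x hx hdom
    left
    have h1 := (exists_subset_of_mass_signWt hx).apply_nonneg hdom
    have h2 : x - weylVec B = 0 := by
      apply eq_zero_of_norm_le (S := S)
      rw [← neg_sub x, map_neg] at h1
      linarith
    rw [sub_eq_zero.1 h2, mass_signWt_weylVec, one_mul]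
    exact ⟨rfl, rfl⟩

end Base

namespace Base

open RootSys MvPolynomial

variable {V : Type} [AddCommGroup V] [Module ℝ V] {S : RootSys V} {B : Base S}

theorem hasSum_mass {w : ℤ → ℝ} {F : V → ℝ} {s : ℝ}
    (hs : HasSum (fun k => prodWt w k * F (B.wt k)) s) : HasSum (fun x => B.mass w x * F x) s := by
  refine (hs.tsum_fiberwise B.wt).of_eq (fun x => ?_) rfl
  rw [tsum_subtype (B.wt ⁻¹' {x}) (fun k => prodWt w k * F (B.wt k)), mass, ← tsum_mul_right]
  refine tsum_congr fun k => ?_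
  simp only [Set.indicator, Set.mem_preimage, Set.mem_singleton_iff]
  split_ifs with h
  · rw [h]
  · rw [zero_mul]

/-- The Gram matrix of the positive roots. -/
noncomputable def gram (B : Base S) : Matrix {α // α ∈ B.Pos} {α // α ∈ B.Pos} ℝ :=
  fun α β => S.I α β

theorem eval_rowForm (k : {α // α ∈ B.Pos} → ℤ) (α : {α // α ∈ B.Pos}) :
    eval (halfShift k) (rowForm B.gram α) = S.I α (B.wt k) := by
  simp only [rowForm, wt, map_sum, map_mul, eval_C, eval_X, map_smul, smul_eq_mul, gram]
  exact Finset.sum_congr rfl fun _ _ => mul_comm _ _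

theorem eval_rowProd (k : {α // α ∈ B.Pos} → ℤ) :
    eval (halfShift k) (rowProd B.gram) = B.rootProd (B.wt k) := by
  rw [rowProd, rootProd, map_prod, ← Finset.prod_coe_sort B.Pos fun α => S.I α (B.wt k)]
  exact Finset.prod_congr rfl fun α _ => eval_rowForm k α

theorem eval_quadPoly (k : {α // α ∈ B.Pos} → ℤ) :
    eval (halfShift k) (quadPoly B.gram) = S.I (B.wt k) (B.wt k) := by
  have h1 : ∀ x, S.I (B.wt k) x = ∑ α, halfShift k α * S.I α x := fun x => by
    simp [wt, LinearMap.sum_apply]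
  rw [quadPoly, map_sum, h1]
  refine Finset.sum_congr rfl fun α _ => ?_
  rw [map_mul, eval_X, eval_rowForm]

/-- The coefficient of the squarefree monomial in the product of the roots. -/
noncomputable def topCoeff (B : Base S) : ℝ := (rowProd B.gram).coeff (allOnes _)

theorem hasSum_rootProd {w : ℤ → ℝ} (hw : OddWeight w) :
    HasSum (fun k => prodWt w k * B.rootProd (B.wt k))
      (B.topCoeff * moment w 1 ^ Fintype.card {α // α ∈ B.Pos}) :=
  (hw.hasSum_top (rowProd_isHomogeneous B.gram)).of_eq (fun k => by rw [eval_rowProd]) rfl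

theorem topCoeff_pos : 0 < B.topCoeff := by
  have h := hasSum_mass (hasSum_rootProd (B := B) signWt_oddWeight)
  rw [moment_signWt 1 odd_one] at h
  norm_num at h
  have hle := le_hasSum h (weylVec B) (fun x _ => by
    by_cases hx : B.mass signWt x = 0
    · rw [hx, zero_mul]
    · rw [(mass_signWt_spec x hx).2]; exact rootProd_weylVec_pos.le)
  rw [mass_signWt_weylVec, one_mul] at hle
  exact rootProd_weylVec_pos.trans_le hle

theorem signWt_norm {F : V → ℝ} {s t : ℝ}
    (hs : HasSum (fun k => prodWt signWt k * F (B.wt k)) s)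
    (ht : HasSum (fun k => prodWt signWt k * (F (B.wt k) * S.I (B.wt k) (B.wt k))) t) :
    t = S.I (weylVec B) (weylVec B) * s := by
  have h1 := hasSum_mass (F := fun x => F x * S.I x x) ht
  refine h1.unique (((hasSum_mass hs).mul_left _).of_eq (fun x => ?_) rfl)
  by_cases hx : B.mass signWt x = 0
  · rw [hx]; ring
  · rw [(mass_signWt_spec x hx).1]; ring

theorem gram_symm (α β : {α // α ∈ B.Pos}) : B.gram α β = B.gram β α := S.symm _ _

namespace Highest

variable {θ : V} {h : ℝ}

theorem card_pos (H : B.Highest θ h) : 0 < Fintype.card {α // α ∈ B.Pos} :=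
  Fintype.card_pos_iff.2 ⟨⟨θ, H.mem_pos⟩⟩

theorem gram_sq (H : B.Highest θ h) (α β : {α // α ∈ B.Pos}) :
    ∑ γ, B.gram α γ * B.gram γ β = h * B.gram α β := by
  rw [gram, ← H.sum_mul, ← Finset.sum_coe_sort B.Pos fun γ => S.I γ α * S.I γ β]
  exact Finset.sum_congr rfl fun γ _ => congrArg (· * _) (S.symm _ _)

theorem coeff_laplacian_mul (B : Base S) :
    (laplacian (rowProd B.gram) * quadPoly B.gram).coeff (allOnes _) = 0 := by
  have hdeg := (laplacian_isHomogeneous (rowProd_isHomogeneous B.gram)).mul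
    (quadPoly_isHomogeneous B.gram)
  by_cases hN : Fintype.card {α // α ∈ B.Pos} - 1 - 1 + 2 = Fintype.card {α // α ∈ B.Pos}
  · rw [hN] at hdeg
    have hP := signWt_oddWeight.tsum_eq_zero
      (laplacian_isHomogeneous (rowProd_isHomogeneous B.gram)) (by omega)
    have hPQ := signWt_oddWeight.hasSum_top hdeg
    have hfac : (fun k => eval (halfShift k) (laplacian (rowProd B.gram))).FactorsThrough B.wt :=
      fun k k' hkk => eval_laplacian_rowProd_congr _ _ _ fun α => by
        rw [eval_rowForm, eval_rowForm, hkk]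
    have hF := hfac.extend_apply (fun _ => 0)
    rw [moment_signWt 1 odd_one] at hPQ
    norm_num at hPQ
    simpa using signWt_norm (F := Function.extend B.wt _ fun _ => 0)
      (hP.of_eq (fun k => by rw [hF]) rfl)
      (hPQ.of_eq (fun k => by rw [hF, eval_quadPoly]) rfl)
  · by_contra hne
    have := hdeg.coeff_eq_zero (d := allOnes _) (by
      rw [Finsupp.degree_eq_sum]
      simpa using Ne.symm hN)
    exact hne this

theorem coeff_laplacian [FiniteDimensional ℝ V] (H : B.Highest θ h) :
    (laplacian (rowProd B.gram * quadPoly B.gram)).coeff (allOnes _) =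
      2 * h * (Module.finrank ℝ V + S.R.card) * B.topCoeff := by
  rw [laplacian_rowProd_mul_quadPoly B.gram gram_symm h H.gram_sq, coeff_add, coeff_C_mul,
    coeff_laplacian_mul B, zero_add]
  have h1 : ∑ α, B.gram α α = h * Module.finrank ℝ V := by
    rw [← H.sum_norm]; exact Finset.sum_coe_sort B.Pos fun α => S.I α α
  rw [h1, card_R (B := B), Fintype.card_coe, topCoeff]
  push_cast
  ring

theorem hasSum_rootProd_mul_norm [FiniteDimensional ℝ V] (H : B.Highest θ h) {w : ℤ → ℝ}
    (hw : OddWeight w) :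
    HasSum (fun k => prodWt w k * (B.rootProd (B.wt k) * S.I (B.wt k) (B.wt k)))
      (2 * h * (Module.finrank ℝ V + S.R.card) * B.topCoeff / 6 *
        (moment w 1 ^ (Fintype.card {α // α ∈ B.Pos} - 1) * moment w 3)) := by
  refine (hw.hasSum_top_add_two ((rowProd_isHomogeneous B.gram).mul
    (quadPoly_isHomogeneous B.gram))).of_eq (fun k => ?_) (by rw [H.coeff_laplacian])
  rw [map_mul, eval_rowProd, eval_quadPoly]

/-- The strange formula of Freudenthal and de Vries. -/
theorem norm_weylVec [FiniteDimensional ℝ V] (H : B.Highest θ h) :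
    12 * S.I (weylVec B) (weylVec B) = h * (Module.finrank ℝ V + S.R.card) := by
  have h1 := hasSum_rootProd (B := B) signWt_oddWeight
  have h2 := H.hasSum_rootProd_mul_norm signWt_oddWeight
  rw [moment_signWt 1 odd_one] at h1 h2
  rw [moment_signWt 3 (by decide)] at h2
  norm_num at h1 h2
  have h3 := signWt_norm h1 h2
  have h4 := (topCoeff_pos (B := B)).ne'
  apply mul_right_cancel₀ h4
  linarith

theorem tsum_coset_refl {F : V → ℝ} {β : V} (hβ : β ∈ S.R)
    (hF : ∀ x, F (S.refl β x) = F x) (x : V) :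
    ∑' m : corootLat S, F (S.refl β x + h • (m : V)) = ∑' m : corootLat S, F (x + h • (m : V)) := by
  let f : corootLat S → corootLat S := fun m => ⟨S.refl β m, refl_mem_corootLat hβ m.2⟩
  have hf : Function.Involutive f := fun m => Subtype.ext (refl_refl hβ m)
  rw [← (hf.toPerm f).tsum_eq]
  refine tsum_congr fun m => ?_
  change F (S.refl β x + h • S.refl β m) = _
  rw [← map_smul, ← map_add, hF]

theorem tsum_coset_add (F : V → ℝ) {m : V} (hm : m ∈ corootLat S) (x : V) :
    ∑' n : corootLat S, F (x + h • m + h • (n : V)) = ∑' n : corootLat S, F (x + h • (n : V)) := by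
  rw [← (Equiv.addLeft (⟨m, hm⟩ : corootLat S)).tsum_eq fun n : corootLat S => F (x + h • (n : V))]
  refine tsum_congr fun n => ?_
  simp [smul_add, add_assoc]

/-- The number of cosets of the scaled coroot lattice that carry mass. -/
noncomputable def cosetCount (B : Base S) (h q : ℝ) : ℝ :=
  ∑' c : V ⧸ (corootLat S).map (DistribSMul.toAddMonoidHom V h),
    if ∃ x : V, (QuotientAddGroup.mk x : V ⧸ (corootLat S).map (DistribSMul.toAddMonoidHom V h)) = c
      ∧ B.mass (thetaWt q) x ≠ 0 then 1 else 0

theorem eq_cosetCount_mul (H : B.Highest θ h) {q : ℝ} (hq0 : 0 < q) (hq1 : q < 1) {p : V → ℝ}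
    (hp : ∀ β ∈ S.R, ∀ x, p (S.refl β x) = -p x) {s : ℝ}
    (hs : HasSum (fun k => prodWt (thetaWt q) k * p (B.wt k)) s) :
    s = cosetCount B h q *
      ∑' m : corootLat S, B.mass (thetaWt q) (weylVec B + h • (m : V)) *
        p (weylVec B + h • (m : V)) := by
  set F : V → ℝ := fun x => B.mass (thetaWt q) x * p x with hFdef
  have hF : ∀ β ∈ S.R, ∀ x, F (S.refl β x) = F x := by
    intro β hβ x
    simp only [hFdef, mass_refl (thetaWt_oddWeight hq0 hq1) hβ, hp β hβ, neg_mul_neg]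
  have h1 := (hasSum_mass hs).tsum_fiberwise
    (QuotientAddGroup.mk (s := (corootLat S).map (DistribSMul.toAddMonoidHom V h)))
  rw [← h1.tsum_eq, cosetCount, ← tsum_mul_right]
  refine tsum_congr fun c => ?_
  refine (tsum_subtype _ F).trans ?_
  split_ifs with hc
  · obtain ⟨x, rfl, hx⟩ := hc
    rw [one_mul, ← H.eq_of_mass_ne_zero hq0 hq1
      (fun x => ∑' m : corootLat S, F (x + h • (m : V)))
      (fun β hβ x => tsum_coset_refl hβ (hF β hβ) x) (fun m hm x => tsum_coset_add F hm x) x hx]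
    have hinj : Function.Injective fun m : corootLat S => x + h • (m : V) := by
      intro m m' hmm
      exact Subtype.ext (smul_right_injective V H.pos.ne' (add_left_cancel hmm))
    have hmem : ∀ y : V, (QuotientAddGroup.mk y :
        V ⧸ (corootLat S).map (DistribSMul.toAddMonoidHom V h)) = QuotientAddGroup.mk x ↔
        ∃ m : corootLat S, x + h • (m : V) = y := by
      intro y
      rw [eq_comm, QuotientAddGroup.eq, AddSubgroup.mem_map]
      constructor
      · rintro ⟨m, hm, h2⟩
        refine ⟨⟨m, hm⟩, ?_⟩
        change h • m = _ at h2
        rw [h2]; abel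
      · rintro ⟨m, rfl⟩
        exact ⟨m, m.2, by simp⟩
    rw [← hinj.tsum_eq]
    · refine tsum_congr fun m => ?_
      rw [Set.indicator_of_mem]
      exact (hmem _).2 ⟨m, rfl⟩
    · intro y hy
      have := Set.mem_of_indicator_ne_zero hy
      exact (hmem y).1 this
  · rw [zero_mul]
    refine (tsum_congr fun x => ?_).trans tsum_zero
    rw [Set.indicator_apply_eq_zero]
    intro hx
    by_contra hne
    exact hc ⟨x, hx, fun h0 => hne (by rw [hFdef] at *; simp only [h0, zero_mul])⟩

/-- The exponents of the theta series. -/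
noncomputable def expo (B : Base S) (h : ℝ) (m : V) : ℝ :=
  S.I (weylVec B + h • m) (weylVec B + h • m) / (2 * h)

/-- The affine theta series. -/
noncomputable def theta (B : Base S) (h q : ℝ) : ℝ :=
  ∑' m : corootLat S, B.rootProd (weylVec B + h • (m : V)) * q ^ expo B h m

/-- The image of the affine theta series under the Euler operator. -/
noncomputable def thetaEuler (B : Base S) (h q : ℝ) : ℝ :=
  ∑' m : corootLat S, B.rootProd (weylVec B + h • (m : V)) * (expo B h m * q ^ expo B h m)

theorem mass_weylVec_add (H : B.Highest θ h) {q : ℝ} (hq0 : 0 < q) {m : V}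
    (hm : m ∈ corootLat S) :
    B.mass (thetaWt q) (weylVec B + h • m) =
      B.mass (thetaWt q) (weylVec B) * q ^ (-expo B h 0) * q ^ expo B h m := by
  rw [H.mass_add hm hq0, mul_assoc, ← Real.rpow_add hq0]
  congr 2
  simp only [expo, smul_zero, add_zero]
  ring

theorem theta_euler_identity [FiniteDimensional ℝ V] (H : B.Highest θ h) {q : ℝ} (hq0 : 0 < q)
    (hq1 : q < 1) (hu : moment (thetaWt q) 1 ≠ 0) :
    theta B h q ≠ 0 ∧ 6 * thetaEuler B h q * moment (thetaWt q) 1 =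
      (Module.finrank ℝ V + S.R.card) * moment (thetaWt q) 3 * theta B h q := by
  have hw := thetaWt_oddWeight hq0 hq1
  have e1 := H.eq_cosetCount_mul hq0 hq1 (fun β hβ x => rootProd_refl hβ x) (hasSum_rootProd hw)
  have e2 := H.eq_cosetCount_mul hq0 hq1 (p := fun x => B.rootProd x * S.I x x)
    (fun β hβ x => by rw [rootProd_refl hβ, refl_isometry hβ, neg_mul])
    (H.hasSum_rootProd_mul_norm hw)
  set A := B.mass (thetaWt q) (weylVec B) * q ^ (-expo B h 0)
  have t1 : ∑' m : corootLat S, B.mass (thetaWt q) (weylVec B + h • (m : V)) *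
      B.rootProd (weylVec B + h • (m : V)) = A * theta B h q := by
    rw [theta, ← tsum_mul_left]
    refine tsum_congr fun m => ?_
    rw [H.mass_weylVec_add hq0 m.2]; ring
  have hh := H.pos.ne'
  have t2 : ∑' m : corootLat S, B.mass (thetaWt q) (weylVec B + h • (m : V)) *
      (B.rootProd (weylVec B + h • (m : V)) *
        S.I (weylVec B + h • (m : V)) (weylVec B + h • (m : V))) =
      A * (2 * h) * thetaEuler B h q := by
    rw [thetaEuler, ← tsum_mul_left]
    refine tsum_congr fun m => ?_
    have : S.I (weylVec B + h • (m : V)) (weylVec B + h • (m : V)) = 2 * h * expo B h m := by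
      rw [expo]; field_simp
    rw [H.mass_weylVec_add hq0 m.2, this]; ring
  rw [t1] at e1
  rw [t2] at e2
  have hκ := (topCoeff_pos (B := B)).ne'
  have hne : B.topCoeff * moment (thetaWt q) 1 ^ Fintype.card {α // α ∈ B.Pos} ≠ 0 :=
    mul_ne_zero hκ (pow_ne_zero _ hu)
  have hth : theta B h q ≠ 0 := fun h0 => hne (by rw [e1, h0]; ring)
  refine ⟨hth, ?_⟩
  have hc : cosetCount B h q * A ≠ 0 := fun h0 => hne (by rw [e1, ← mul_assoc, h0, zero_mul])
  apply mul_left_cancel₀ (mul_ne_zero hc hh)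
  have hpow : moment (thetaWt q) 1 ^ (Fintype.card {α // α ∈ B.Pos} - 1) * moment (thetaWt q) 1 =
      moment (thetaWt q) 1 ^ Fintype.card {α // α ∈ B.Pos} := by
    rw [← pow_succ, Nat.sub_add_cancel H.card_pos]
  calc cosetCount B h q * A * h * (6 * thetaEuler B h q * moment (thetaWt q) 1) =
      3 * (cosetCount B h q * (A * (2 * h) * thetaEuler B h q)) * moment (thetaWt q) 1 := by ring
    _ = h * (Module.finrank ℝ V + S.R.card) * moment (thetaWt q) 3 *
        (B.topCoeff * (moment (thetaWt q) 1 ^ (Fintype.card {α // α ∈ B.Pos} - 1) *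
          moment (thetaWt q) 1)) := by rw [← e2]; ring
    _ = _ := by rw [hpow, e1]; ring

end Highest

end Base

section

open Filter Topology

theorem hasDerivAt_tsum_rpow {ι : Type*} {c e : ι → ℝ} (he : ∀ i, 0 ≤ e i)
    (h0 : ∀ q : ℝ, 0 < q → q < 1 → Summable fun i => |c i| * q ^ e i)
    (h1 : ∀ q : ℝ, 0 < q → q < 1 → Summable fun i => |c i| * (e i * q ^ e i)) {q : ℝ}
    (hq0 : 0 < q) (hq1 : q < 1) :
    HasDerivAt (fun x : ℝ => ∑' i, c i * x ^ e i) ((∑' i, c i * (e i * q ^ e i)) / q) q := by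
  obtain ⟨b, hqb, hb1⟩ := exists_between hq1
  obtain ⟨a, ha0, haq⟩ := exists_between hq0
  have hsum : Summable fun i => |c i| * (e i * b ^ e i) / a :=
    (h1 b (hq0.trans hqb) hb1).div_const a
  have hd : ∀ i, ∀ x ∈ Set.Ioo a b,
      HasDerivAt (fun x : ℝ => c i * x ^ e i) (c i * (e i * x ^ (e i - 1))) x := fun i x hx =>
    (Real.hasDerivAt_rpow_const (Or.inl (ha0.trans hx.1).ne')).const_mul _
  have hbound : ∀ i, ∀ x ∈ Set.Ioo a b,
      ‖c i * (e i * x ^ (e i - 1))‖ ≤ |c i| * (e i * b ^ e i) / a := by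
    intro i x hx
    have hx0 := ha0.trans hx.1
    rw [Real.norm_eq_abs, abs_mul, Real.rpow_sub_one hx0.ne',
      abs_of_nonneg (mul_nonneg (he i) (div_nonneg (Real.rpow_nonneg hx0.le _) hx0.le)),
      mul_div_assoc, mul_div_assoc]
    have : x ^ e i ≤ b ^ e i := Real.rpow_le_rpow hx0.le hx.2.le (he i)
    have h3 := he i
    have h4 := hx.1.le
    have h5 : 0 ≤ b ^ e i := Real.rpow_nonneg (hq0.trans hqb).le _
    gcongr
  have hs0 : Summable fun i => c i * q ^ e i := by
    refine Summable.of_abs ((h0 q hq0 hq1).congr fun i => ?_)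
    rw [abs_mul, abs_of_nonneg (Real.rpow_nonneg hq0.le _)]
  have := hasDerivAt_tsum_of_isPreconnected hsum isOpen_Ioo isPreconnected_Ioo hd hbound
    ⟨haq, hqb⟩ hs0 ⟨haq, hqb⟩
  refine this.congr_deriv ?_
  rw [← tsum_div_const]
  refine tsum_congr fun i => ?_
  rw [Real.rpow_sub_one hq0.ne']
  ring

theorem tendsto_tsum_rpow {ι : Type*} {c e : ι → ℝ} {E : ℝ} (he : ∀ i, E ≤ e i)
    (h0 : ∀ q : ℝ, 0 < q → q < 1 → Summable fun i => |c i| * q ^ e i) :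
    Tendsto (fun x : ℝ => (∑' i, c i * x ^ e i) * x ^ (-E)) (𝓝[>] 0)
      (𝓝 (∑' i, if e i = E then c i else 0)) := by
  have hmem : Set.Ioo (0 : ℝ) (1 / 2) ∈ 𝓝[>] (0 : ℝ) := Ioo_mem_nhdsGT (by norm_num)
  have h1 : Tendsto (fun x : ℝ => ∑' i, c i * x ^ (e i - E)) (𝓝[>] 0)
      (𝓝 (∑' i, if e i = E then c i else 0)) := by
    refine tendsto_tsum_of_dominated_convergence
      (bound := fun i => |c i| * (1 / 2 : ℝ) ^ e i * (1 / 2 : ℝ) ^ (-E))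
      ((h0 (1 / 2) (by norm_num) (by norm_num)).mul_right _) (fun i => ?_) ?_
    · split_ifs with hi
      · simp [hi]
      · have hpos : 0 < e i - E := sub_pos.2 ((he i).lt_of_ne (Ne.symm hi))
        have := ((Real.continuousAt_rpow_const 0 (e i - E) (Or.inr hpos.le)).tendsto).const_mul (c i)
        rw [Real.zero_rpow hpos.ne', mul_zero] at this
        exact this.mono_left nhdsWithin_le_nhds
    · filter_upwards [hmem] with x hx i
      rw [Real.norm_eq_abs, abs_mul, abs_of_nonneg (Real.rpow_nonneg hx.1.le _), mul_assoc,
        ← Real.rpow_add (by norm_num), ← sub_eq_add_neg]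
      exact mul_le_mul_of_nonneg_left
        (Real.rpow_le_rpow hx.1.le hx.2.le (sub_nonneg.2 (he i))) (abs_nonneg _)
  refine h1.congr' ?_
  filter_upwards [hmem] with x hx
  rw [← tsum_mul_right]
  refine tsum_congr fun i => ?_
  rw [sub_eq_add_neg, Real.rpow_add hx.1, mul_assoc]

theorem thetaWt_mul (q : ℝ) (k : ℤ) (x : ℝ) :
    thetaWt q k * x = ((-1) ^ k * x) * q ^ (((k : ℝ) + 1 / 2) ^ 2 / 2) := by
  rw [thetaWt]; ring

theorem summable_thetaWt_expansion {q : ℝ} (hq0 : 0 < q) (hq1 : q < 1) :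
    Summable fun k : ℤ => |(-1 : ℝ) ^ k * ((k : ℝ) + 1 / 2)| * q ^ (((k : ℝ) + 1 / 2) ^ 2 / 2) := by
  refine (summable_abs_thetaWt q hq0 hq1 1).congr fun k => ?_
  rw [pow_one, ← abs_mul, thetaWt_mul, abs_mul,
    abs_of_nonneg (Real.rpow_nonneg hq0.le (((k : ℝ) + 1 / 2) ^ 2 / 2))]

theorem moment_one_eq (q : ℝ) : moment (thetaWt q) 1 =
    ∑' k : ℤ, ((-1) ^ k * ((k : ℝ) + 1 / 2)) * q ^ (((k : ℝ) + 1 / 2) ^ 2 / 2) := by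
  rw [moment]
  exact tsum_congr fun k => by rw [pow_one, thetaWt_mul]

theorem hasDerivAt_moment {q : ℝ} (hq0 : 0 < q) (hq1 : q < 1) :
    HasDerivAt (fun x => moment (thetaWt x) 1) (moment (thetaWt q) 3 / 2 / q) q := by
  simp only [moment_one_eq]
  convert hasDerivAt_tsum_rpow (fun k : ℤ => by positivity)
    (fun q h0 h1 => summable_thetaWt_expansion h0 h1) (fun q h0 h1 => ?_) hq0 hq1 using 2
  · rw [moment, ← tsum_div_const]
    refine tsum_congr fun k => ?_
    rw [thetaWt]; ring
  · refine ((summable_abs_thetaWt q h0 h1 3).div_const 2).congr fun k => ?_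
    have : |(k : ℝ) + 1 / 2| ^ 3 = |(k : ℝ) + 1 / 2| * ((k : ℝ) + 1 / 2) ^ 2 := by
      rw [pow_succ', sq_abs]
    rw [this, abs_thetaWt q h0, abs_mul, abs_zpow, abs_neg, abs_one, one_zpow]
    ring

theorem tendsto_moment : Tendsto (fun q : ℝ => moment (thetaWt q) 1 * q ^ (-(1 / 8) : ℝ)) (𝓝[>] 0)
    (𝓝 1) := by
  have hsq : ∀ k : ℤ, (1 / 8 : ℝ) ≤ ((k : ℝ) + 1 / 2) ^ 2 / 2 ∧
      (((k : ℝ) + 1 / 2) ^ 2 / 2 = 1 / 8 ↔ k ∈ ({0, -1} : Finset ℤ)) := by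
    intro k
    have h1 : ((k : ℝ) + 1 / 2) ^ 2 / 2 = 1 / 8 + ((k * (k + 1) : ℤ) : ℝ) / 2 := by
      push_cast; ring
    have h2 : 0 ≤ k * (k + 1) := by
      rcases le_or_gt 0 k with h | h <;> nlinarith
    have h3 : (0 : ℝ) ≤ ((k * (k + 1) : ℤ) : ℝ) := by exact_mod_cast h2
    refine ⟨by linarith, ?_⟩
    rw [h1, Finset.mem_insert, Finset.mem_singleton, add_eq_left, div_eq_zero_iff, Int.cast_eq_zero,
      mul_eq_zero]
    constructor
    · rintro ((h | h) | h)
      · exact Or.inl h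
      · right; omega
      · norm_num at h
    · rintro (h | h)
      · exact Or.inl (Or.inl h)
      · left; right; omega
  have := tendsto_tsum_rpow (E := 1 / 8) (fun k : ℤ => (hsq k).1)
    (fun q h0 h1 => summable_thetaWt_expansion h0 h1)
  simp only [← moment_one_eq] at this
  convert this using 2
  rw [tsum_eq_sum (s := {0, -1}) fun k hk => if_neg fun h => hk ((hsq k).2.1 h),
    Finset.sum_pair (by norm_num), if_pos ((hsq 0).2.2 (by simp)), if_pos ((hsq (-1)).2.2 (by simp))]
  norm_num

theorem moment_eq_eta {q : ℝ} (hq0 : 0 < q) (hq1 : q < 1) :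
    moment (thetaWt q) 1 = eta q ^ 3 := by
  rw [← (hasSum_eta_cube q hq0 hq1).tsum_eq, moment]
  exact tsum_congr fun k => by rw [pow_one]

theorem eta_pos {q : ℝ} (hq0 : 0 < q) (hq1 : q < 1) : 0 < eta q :=
  mul_pos (Real.rpow_pos_of_pos hq0 _) (tprod_one_sub_pow_pos q hq0 hq1)

namespace Base.Highest

open RootSys

variable {V : Type} [AddCommGroup V] [Module ℝ V] {S : RootSys V} {B : Base S} {θ : V} {h : ℝ}

theorem expo_nonneg (H : B.Highest θ h) (m : V) : 0 ≤ expo B h m := by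
  refine div_nonneg ?_ (by linarith [H.pos])
  by_cases h0 : weylVec B + h • m = 0
  · rw [h0]; simp
  · exact (S.posdef _ h0).le

theorem expo_zero_lt (H : B.Highest θ h) {m : V} (hm : m ∈ corootLat S) (h0 : m ≠ 0) :
    expo B h 0 < expo B h m := by
  have := H.norm_lt hm h0
  have h1 := H.pos
  simp only [expo, smul_zero, add_zero]
  gcongr

theorem expo_zero [FiniteDimensional ℝ V] (H : B.Highest θ h) :
    expo B h 0 = ((Module.finrank ℝ V + S.R.card : ℕ) : ℝ) / 24 := by
  have h1 := H.norm_weylVec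
  have h2 := H.pos
  simp only [expo, smul_zero, add_zero]
  rw [div_eq_div_iff (by positivity) (by norm_num)]
  push_cast
  linarith

theorem summable_theta (H : B.Highest θ h) {q : ℝ} (hq0 : 0 < q) (hq1 : q < 1) :
    (Summable fun m : corootLat S =>
      |B.rootProd (weylVec B + h • (m : V))| * q ^ expo B h m) ∧
    Summable fun m : corootLat S =>
      |B.rootProd (weylVec B + h • (m : V))| * (expo B h m * q ^ expo B h m) := by
  have hw := thetaWt_oddWeight hq0 hq1
  have hh := H.pos
  have hwt : ∀ m : corootLat S, B.wt (B.transIdx m 0) = weylVec B + h • (m : V) := by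
    intro m
    rw [H.wt_transIdx m.2, sub_eq_zero.1 ((wt_sub_weylVec (0 : {α // α ∈ B.Pos} → ℤ)).trans _)]
    simp
  have hinj : Function.Injective fun m : corootLat S => B.transIdx (m : V) 0 := by
    intro m m' hmm
    have := congrArg B.wt hmm
    simp only [hwt] at this
    exact Subtype.ext (smul_right_injective V hh.ne' (add_left_cancel this))
  set A := |prodWt (thetaWt q) (0 : {α // α ∈ B.Pos} → ℤ)| * q ^ (-expo B h 0) with hA
  have hApos : 0 < A := by
    refine mul_pos (abs_pos.2 (Finset.prod_ne_zero_iff.2 fun α _ => ?_)) (Real.rpow_pos_of_pos hq0 _)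
    rw [thetaWt]
    exact mul_ne_zero (zpow_ne_zero _ (by norm_num)) (Real.rpow_pos_of_pos hq0 _).ne'
  have hW : ∀ m : corootLat S, |prodWt (thetaWt q) (B.transIdx m 0)| = A * q ^ expo B h m := by
    intro m
    have h0 : B.wt 0 = weylVec B := by
      have := hwt 0
      rwa [ZeroMemClass.coe_zero, transIdx_zero, smul_zero, add_zero] at this
    rw [H.prodWt_transIdx m.2 hq0, h0, abs_mul, abs_of_pos (Real.rpow_pos_of_pos hq0 _), hA,
      mul_assoc, ← Real.rpow_add hq0]
    congr 2
    simp only [expo, smul_zero, add_zero]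
    ring
  constructor
  · have h1 := ((hw.hasSum_eval (rowProd B.gram)).1.comp_injective hinj).mul_left A⁻¹
    refine h1.congr fun m => ?_
    simp only [Function.comp_apply]
    rw [abs_mul, hW, eval_rowProd, hwt]
    field_simp
  · have h1 := ((hw.hasSum_eval (rowProd B.gram * quadPoly B.gram)).1.comp_injective hinj).mul_left
      (A⁻¹ * (2 * h)⁻¹)
    refine h1.congr fun m => ?_
    simp only [Function.comp_apply]
    have hex : S.I (weylVec B + h • (m : V)) (weylVec B + h • (m : V)) = 2 * h * expo B h m := by
      rw [expo]; field_simp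
    rw [abs_mul, hW, map_mul, eval_rowProd, eval_quadPoly, hwt, hex, abs_mul,
      abs_of_nonneg (mul_nonneg (by linarith) (H.expo_nonneg m))]
    field_simp

theorem hasDerivAt_theta (H : B.Highest θ h) {q : ℝ} (hq0 : 0 < q) (hq1 : q < 1) :
    HasDerivAt (theta B h) (thetaEuler B h q / q) q :=
  hasDerivAt_tsum_rpow (fun m : corootLat S => H.expo_nonneg m)
    (fun _ h0 h1 => (H.summable_theta h0 h1).1) (fun _ h0 h1 => (H.summable_theta h0 h1).2) hq0 hq1

theorem tendsto_theta (H : B.Highest θ h) :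
    Tendsto (fun q => theta B h q * q ^ (-expo B h 0)) (𝓝[>] 0) (𝓝 (B.rootProd (weylVec B))) := by
  have := tendsto_tsum_rpow (E := expo B h 0) (c := fun m : corootLat S =>
      B.rootProd (weylVec B + h • (m : V))) (e := fun m : corootLat S => expo B h m)
    (fun m => by
      by_cases h0 : (m : V) = 0
      · rw [h0]
      · exact (H.expo_zero_lt m.2 h0).le)
    (fun _ h0 h1 => (H.summable_theta h0 h1).1)
  have hlim : (∑' m : corootLat S, if expo B h m = expo B h 0 then
      B.rootProd (weylVec B + h • (m : V)) else 0) = B.rootProd (weylVec B) := by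
    rw [tsum_eq_single 0]
    · simp
    · intro m hm
      exact if_neg (H.expo_zero_lt m.2 (by simpa using hm)).ne'
  rw [hlim] at this
  exact this

theorem theta_cube [FiniteDimensional ℝ V] (H : B.Highest θ h) {q : ℝ} (hq0 : 0 < q)
    (hq1 : q < 1) : theta B h q ^ 3 =
      B.rootProd (weylVec B) ^ 3 *
        moment (thetaWt q) 1 ^ (Module.finrank ℝ V + S.R.card) := by
  set D := Module.finrank ℝ V + S.R.card with hD
  have hu : ∀ x ∈ Set.Ioo (0 : ℝ) 1, moment (thetaWt x) 1 ≠ 0 := fun x hx => by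
    rw [moment_eq_eta hx.1 hx.2]; exact pow_ne_zero _ (eta_pos hx.1 hx.2).ne'
  set G : ℝ → ℝ := fun x => theta B h x ^ 3 / moment (thetaWt x) 1 ^ D with hG
  have hderiv : ∀ x ∈ Set.Ioo (0 : ℝ) 1, HasDerivAt G 0 x := by
    intro x hx
    have h1 := (H.hasDerivAt_theta hx.1 hx.2).pow 3
    have h2 := (hasDerivAt_moment hx.1 hx.2).pow D
    refine (h1.div h2 (pow_ne_zero _ (hu x hx))).congr_deriv ?_
    have h3 := (H.theta_euler_identity hx.1 hx.2 (hu x hx)).2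
    have hx0 := hx.1.ne'
    have hD0 : D = D - 1 + 1 := by
      have := Finset.card_pos.2 ⟨θ, H.mem⟩
      omega
    have hux := hu x hx
    have hpow : moment (thetaWt x) 1 ^ D = moment (thetaWt x) 1 ^ (D - 1) * moment (thetaWt x) 1 := by
      rw [← pow_succ, ← hD0]
    have hcast : ((Module.finrank ℝ V : ℝ) + S.R.card) = D := by rw [hD]; push_cast; rfl
    rw [hcast] at h3
    rw [div_eq_zero_iff]
    left
    simp only [Pi.pow_apply]
    rw [hpow]
    push_cast
    linear_combination (theta B h x ^ 2 * moment (thetaWt x) 1 ^ (D - 1) / (2 * x)) * h3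
  have hconst : ∀ x ∈ Set.Ioo (0 : ℝ) 1, G x = G q := fun x hx =>
    isOpen_Ioo.is_const_of_deriv_eq_zero isPreconnected_Ioo
      (fun y hy => (hderiv y hy).differentiableAt.differentiableWithinAt)
      (fun y hy => (hderiv y hy).deriv) hx ⟨hq0, hq1⟩
  have hmem : Set.Ioo (0 : ℝ) 1 ∈ 𝓝[>] (0 : ℝ) := Ioo_mem_nhdsGT (by norm_num)
  have hlim : Tendsto G (𝓝[>] 0) (𝓝 (B.rootProd (weylVec B) ^ 3 / 1 ^ D)) := by
    refine ((H.tendsto_theta.pow 3).div (tendsto_moment.pow D) (by simp)).congr' ?_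
    filter_upwards [hmem] with x hx
    have h1 : (x ^ (-expo B h 0)) ^ 3 = (x ^ (-(1 / 8) : ℝ)) ^ D := by
      rw [← Real.rpow_natCast, ← Real.rpow_natCast, ← Real.rpow_mul hx.1.le,
        ← Real.rpow_mul hx.1.le, H.expo_zero, ← hD]
      congr 1
      push_cast
      ring
    simp only [hG, Pi.div_apply]
    rw [mul_pow, mul_pow, h1,
      mul_div_mul_right _ _ (pow_ne_zero _ (Real.rpow_pos_of_pos hx.1 _).ne')]
  have heq := tendsto_nhds_unique (hlim.congr' (by
    filter_upwards [hmem] with x hx using hconst x hx)) tendsto_const_nhds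
  rw [one_pow, div_one] at heq
  rw [heq, hG]
  exact (div_mul_cancel₀ _ (pow_ne_zero _ (hu q ⟨hq0, hq1⟩))).symm

theorem rootProd_eq (m : V) :
    B.rootProd (weylVec B + m) = B.rootProd (weylVec B) * dFun B m := by
  rw [dFun, rootProd, rootProd, ← Finset.prod_mul_distrib]
  refine Finset.prod_congr rfl fun α hα => ?_
  have := (weylVec_pos hα).ne'
  rw [S.symm α, S.symm α, add_comm m]
  field_simp

theorem macdonald [FiniteDimensional ℝ V] (H : B.Highest θ h) {q : ℝ} (hq0 : 0 < q)
    (hq1 : q < 1) :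
    (Summable fun m : corootLat S => |dFun B (h • (m : V)) * q ^ expo B h m|) ∧
    eta q ^ (Module.finrank ℝ V + S.R.card) =
      ∑' m : corootLat S, dFun B (h • (m : V)) * q ^ expo B h m := by
  have hρ := rootProd_weylVec_pos (B := B)
  constructor
  · refine ((H.summable_theta hq0 hq1).1.mul_left (B.rootProd (weylVec B))⁻¹).congr fun m => ?_
    rw [rootProd_eq, abs_mul, abs_mul, abs_of_pos hρ, abs_of_pos (Real.rpow_pos_of_pos hq0 _)]
    field_simp
  · have h1 : theta B h q = B.rootProd (weylVec B) *
        ∑' m : corootLat S, dFun B (h • (m : V)) * q ^ expo B h m := by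
      rw [theta, ← tsum_mul_left]
      refine tsum_congr fun m => ?_
      rw [rootProd_eq, mul_assoc]
    have h2 := H.theta_cube hq0 hq1
    rw [h1, mul_pow, moment_eq_eta hq0 hq1, ← pow_mul, mul_comm 3, pow_mul] at h2
    exact ((Odd.strictMono_pow (by decide : Odd 3)).injective
      (mul_left_cancel₀ (pow_ne_zero 3 hρ.ne') h2)).symm

end Base.Highest

end

section Scaling

variable {V : Type} [AddCommGroup V] [Module ℝ V]

/-- The same root system, with its form multiplied by `t > 0`. -/
noncomputable def RootSys.scale (S : RootSys V) (t : ℝ) (ht : 0 < t) : RootSys V where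
  I := t • S.I
  symm x y := by simp [S.symm x y]
  posdef x hx := by simpa using mul_pos ht (S.posdef x hx)
  R := S.R
  zero_notmem := S.zero_notmem
  spanning := S.spanning
  reduced := S.reduced
  integral α hα β hβ := by
    obtain ⟨n, hn⟩ := S.integral α hα β hβ
    refine ⟨n, hn ▸ ?_⟩
    simp only [LinearMap.smul_apply, map_smul, smul_eq_mul]
    field_simp
  reflect α hα β hβ := by
    convert S.reflect α hα β hβ using 3
    simp only [LinearMap.smul_apply, map_smul, smul_eq_mul]
    field_simp
  irred R₁ R₂ h h0 := S.irred R₁ R₂ h fun α hα β hβ => by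
    simpa [ht.ne'] using h0 α hα β hβ

variable {S : RootSys V}

/-- The same positive and simple roots, for the rescaled form. -/
def Base.scale (B : Base S) (t : ℝ) (ht : 0 < t) : Base (S.scale t ht) where
  Pos := B.Pos
  Pi := B.Pi
  pos_sub := B.pos_sub
  mem_or_neg := B.mem_or_neg
  not_both := B.not_both
  pi_sub := B.pi_sub
  indep := B.indep
  decomp := B.decomp

theorem Base.dFun_scale (B : Base S) {t : ℝ} (ht : 0 < t) (x : V) :
    dFun (B.scale t ht) x = dFun B x := by
  refine Finset.prod_congr rfl fun α _ => ?_
  change t * S.I (x + weylVec B) α / (t * S.I (weylVec B) α) = _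
  rw [mul_div_mul_left _ _ ht.ne']

theorem RootSys.smul_mem_corootLat_iff {t : ℝ} (ht : 0 < t) {m : V} :
    t • m ∈ corootLat S ↔ m ∈ corootLat (S.scale t ht) := by
  have hc : ∀ α : V, (2 / (S.scale t ht).I α α) • α = t⁻¹ • (2 / S.I α α) • α := fun α => by
    change (2 / (t * S.I α α)) • α = _
    rw [smul_smul, mul_comm t, div_mul_eq_div_div, inv_mul_eq_div]
  constructor
  · intro hm
    have key : corootLat S ≤ (corootLat (S.scale t ht)).comap
        (DistribSMul.toAddMonoidHom V t⁻¹) := by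
      refine (AddSubgroup.closure_le _).2 ?_
      rintro _ ⟨α, hα, rfl⟩
      refine AddSubgroup.subset_closure ⟨α, hα, ?_⟩
      rw [hc]; rfl
    have := key hm
    rwa [AddSubgroup.mem_comap, DistribSMul.toAddMonoidHom_apply, inv_smul_smul₀ ht.ne'] at this
  · intro hm
    have key : corootLat (S.scale t ht) ≤ (corootLat S).comap
        (DistribSMul.toAddMonoidHom V t) := by
      refine (AddSubgroup.closure_le _).2 ?_
      rintro _ ⟨α, hα, rfl⟩
      refine AddSubgroup.subset_closure ⟨α, hα, ?_⟩
      rw [hc, DistribSMul.toAddMonoidHom_apply, smul_inv_smul₀ ht.ne']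
    exact key hm

end Scaling

/-- **Macdonald identity, untwisted case.** -/
theorem macdonald_untwisted (V : Type) [AddCommGroup V] [Module ℝ V]
    [FiniteDimensional ℝ V]
    (S : RootSys V) (B : Base S)
    -- θ is the highest root
    (θ : V) (hθR : θ ∈ S.R)
    (hθhigh : ∀ α ∈ S.R, ∃ c : V → ℕ, θ - α = ∑ b ∈ B.Pi, (c b : ℝ) • b)
    -- the dual Coxeter number h^∨ = 1 + I(ρ_f, θ^∨)
    (hv : ℝ) (hhv : hv = 1 + S.I (weylVec B) ((2 / S.I θ θ) • θ))
    -- c = (I(θ,θ)/2) · h^∨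
    (c : ℝ) (hc : c = S.I θ θ / 2 * hv)
    -- D = l + |R_f|
    (D : ℕ) (hD : D = Module.finrank ℝ V + S.R.card)
    (q : ℝ) (hq0 : 0 < q) (hq1 : q < 1) :
    Summable (fun γ : {x : V // ∃ y ∈ corootLat S, x = c • y} =>
      |dFun B γ.1 * q ^ (2 / S.I θ θ *
        (S.I (weylVec B + γ.1) (weylVec B + γ.1) / (2 * hv)))|) ∧
    eta q ^ D = ∑' γ : {x : V // ∃ y ∈ corootLat S, x = c • y},
      dFun B γ.1 * q ^ (2 / S.I θ θ *
        (S.I (weylVec B + γ.1) (weylVec B + γ.1) / (2 * hv))) := by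

  have hθ : 0 < S.I θ θ := S.posdef θ fun h0 => S.zero_notmem (h0 ▸ hθR)
  obtain ⟨t, ht, htθ⟩ : ∃ t : ℝ, 0 < t ∧ t = 2 / S.I θ θ := ⟨_, by positivity, rfl⟩
  have H : (B.scale t ht).Highest θ hv :=
    { mem := hθR
      high := hθhigh
      norm := by
        change t * S.I θ θ = 2
        rw [htθ]; field_simp
      dual := by
        change hv = 1 + t * S.I (weylVec B) θ
        rw [hhv, htθ, map_smul, smul_eq_mul] }
  have hh := H.pos
  have hcy : ∀ y : V, c • y = hv • t⁻¹ • y := fun y => by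
    rw [smul_smul, hc, htθ, inv_div, mul_comm]
  let f : corootLat (S.scale t ht) ≃ {x : V // ∃ y ∈ corootLat S, x = c • y} :=
    Equiv.ofBijective
      (fun m => ⟨hv • (m : V), t • (m : V), (RootSys.smul_mem_corootLat_iff ht).2 m.2, by
        rw [hcy, inv_smul_smul₀ ht.ne']⟩)
      ⟨fun m m' h => Subtype.ext (smul_right_injective V hh.ne' (congrArg Subtype.val h)), by
        rintro ⟨_, y, hy, rfl⟩
        refine ⟨⟨t⁻¹ • y, (RootSys.smul_mem_corootLat_iff ht).1 ?_⟩, Subtype.ext (hcy y).symm⟩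
        rwa [smul_inv_smul₀ ht.ne']⟩
  have hterm : ∀ m : corootLat (S.scale t ht),
      dFun B (f m).1 * q ^ (2 / S.I θ θ *
        (S.I (weylVec B + (f m).1) (weylVec B + (f m).1) / (2 * hv))) =
      dFun (B.scale t ht) (hv • (m : V)) * q ^ Base.Highest.expo (B.scale t ht) hv m := fun m => by
    rw [Base.dFun_scale, ← htθ, ← mul_div_assoc]
    rfl
  obtain ⟨h1, h2⟩ := H.macdonald hq0 hq1
  constructor
  · rw [← f.summable_iff]
    exact h1.congr fun m => congrArg abs (hterm m).symm
  · rw [hD, ← f.tsum_eq]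
    exact h2.trans (tsum_congr fun m => (hterm m).symm)
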